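/- arXiv:1604.04978 — 3 statements merged into one kernel-verified Lean document; each statement's English description precedes it below -/
import Mathlib

section
/- For any connected graph G on n vertices and any permutation π of its vertices, rt(G, π) = O(n); concretely, every permutation on a tree (hence on any connected graph via a spanning tree) can be routed in at most 3n matching steps. -/
/-- A single routing step on `G`: an involutive permutation that swaps the pebbles
on the endpoints of each edge of a matching of `G`. -/
def IsMatchingStep {V : Type*} (G : SimpleGraph V) (σ : Equiv.Perm V) : Prop :=
  (∀ v, σ (σ v) = v) ∧ ∀ v, σ v ≠ v → G.Adj v (σ v)

/-- The permutation `π` (giving the destination of each pebble) can be routed on `G`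
in `k` matching steps. -/
def RoutableIn {V : Type*} (G : SimpleGraph V) (π : Equiv.Perm V) (k : ℕ) : Prop :=
  ∃ L : List (Equiv.Perm V), L.length = k ∧ (∀ σ ∈ L, IsMatchingStep G σ) ∧
    L.reverse.prod = π

/-- The routing time `rt(G, π)`: the minimum number of matching steps needed to
route `π` on `G`. -/
noncomputable def routingTime {V : Type*} (G : SimpleGraph V) (π : Equiv.Perm V) : ℕ :=
  sInf {k | RoutableIn G π k}

/-- The routing number `rt(G)`: the maximum of `rt(G, π)` over all permutations `π`. -/
noncomputable def routingNumber {V : Type*} (G : SimpleGraph V) : ℕ :=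
  sSup (Set.range fun π : Equiv.Perm V => routingTime G π)

section

open Equiv

open scoped Classical

variable {V : Type*} {G : SimpleGraph V}

/-- `f` can be routed on `G` in `k` matching steps that fix every vertex outside `S`. -/
def RoutableOn (G : SimpleGraph V) (S : Finset V) : ℕ → Perm V → Prop
  | 0, f => f = 1
  | k + 1, f => ∃ σ, IsMatchingStep G σ ∧ (∀ v ∉ S, σ v = v) ∧ RoutableOn G S k (f * σ)

namespace RoutableOn

theorem one (S : Finset V) : ∀ k, RoutableOn G S k 1
  | 0 => rfl
  | k + 1 => ⟨1, ⟨fun _ => rfl, fun _ h => (h rfl).elim⟩, fun _ _ => rfl, by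
      simpa using one S k⟩

theorem add {S : Finset V} {k : ℕ} (m : ℕ) {f : Perm V} (h : RoutableOn G S k f) :
    RoutableOn G S (k + m) f := by
  induction k generalizing f with
  | zero => obtain rfl : f = 1 := h; exact one S _
  | succ k ih =>
    obtain ⟨σ, h1, h2, h3⟩ := h
    rw [Nat.add_right_comm]
    exact ⟨σ, h1, h2, ih h3⟩

theorem mono {S : Finset V} {k l : ℕ} (hkl : k ≤ l) {f : Perm V} (h : RoutableOn G S k f) :
    RoutableOn G S l f := by
  obtain ⟨m, rfl⟩ := Nat.exists_eq_add_of_le hkl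
  exact h.add m

theorem mono_set {S S' : Finset V} (hS : S ⊆ S') {k : ℕ} {f : Perm V}
    (h : RoutableOn G S k f) : RoutableOn G S' k f := by
  induction k generalizing f with
  | zero => exact h
  | succ k ih =>
    obtain ⟨σ, h1, h2, h3⟩ := h
    exact ⟨σ, h1, fun v hv => h2 v fun hv' => hv (hS hv'), ih h3⟩

theorem apply_eq_of_notMem {S : Finset V} {k : ℕ} {f : Perm V} (h : RoutableOn G S k f) :
    ∀ v ∉ S, f v = v := by
  induction k generalizing f with
  | zero => obtain rfl : f = 1 := h; exact fun _ _ => rfl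
  | succ k ih =>
    obtain ⟨σ, h1, h2, h3⟩ := h
    intro v hv
    have := ih h3 v hv
    rwa [Perm.mul_apply, h2 v hv] at this

theorem mul_of_disjoint {S S' : Finset V} (hS : Disjoint S S') {k : ℕ} {f f' : Perm V}
    (h : RoutableOn G S k f) (h' : RoutableOn G S' k f') : RoutableOn G (S ∪ S') k (f * f') := by
  induction k generalizing f f' with
  | zero =>
    obtain rfl : f = 1 := h
    obtain rfl : f' = 1 := h'
    exact one _ 0
  | succ k ih =>
    have hf' := h'.apply_eq_of_notMem
    obtain ⟨σ, h1, h2, h3⟩ := h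
    obtain ⟨τ, h1', h2', h3'⟩ := h'
    have hd : ∀ {v}, v ∈ S → v ∉ S' := fun hv => Finset.disjoint_left.1 hS hv
    have disj : ∀ {ρ : Perm V}, (∀ v ∉ S', ρ v = v) → Perm.Disjoint ρ σ := fun hρ v => by
      by_cases hv : v ∈ S
      · exact Or.inl (hρ v (hd hv))
      · exact Or.inr (h2 v hv)
    have hστ := disj h2'
    refine ⟨σ * τ, ⟨fun v => ?_, fun v hv => ?_⟩, fun v hv => ?_, ?_⟩
    · have hc : (σ * τ) * (σ * τ) = (σ * σ) * (τ * τ) := by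
        rw [mul_assoc, ← mul_assoc τ, hστ.commute.eq]; simp only [mul_assoc]
      have : ((σ * τ) * (σ * τ)) v = v := by
        rw [hc]; simp only [Perm.mul_apply]; rw [h1'.1, h1.1]
      exact this
    · rw [Perm.mul_apply] at hv ⊢
      rcases hστ v with h | h
      · rw [h] at hv ⊢; exact h1.2 v hv
      · have : σ (τ v) = τ v := by
          have := congrArg (fun ρ : Perm V => ρ v) hστ.commute.eq
          simp only [Perm.mul_apply, h] at this
          exact this.symm
        rw [this] at hv ⊢; exact h1'.2 v hv
    · rw [Finset.mem_union, not_or] at hv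
      rw [Perm.mul_apply, h2' v hv.2, h2 v hv.1]
    · have : f * f' * (σ * τ) = (f * σ) * (f' * τ) := by
        rw [mul_assoc, ← mul_assoc f', (disj hf').commute.eq]; simp only [mul_assoc]
      rw [this]
      exact ih h3 h3'

theorem routableIn {S : Finset V} {k : ℕ} {f : Perm V} (h : RoutableOn G S k f) :
    RoutableIn G f k := by
  induction k generalizing f with
  | zero => exact ⟨[], rfl, by simp, by obtain rfl : f = 1 := h; rfl⟩
  | succ k ih =>
    obtain ⟨σ, h1, h2, h3⟩ := h
    obtain ⟨L, hL, hs, hp⟩ := ih h3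
    refine ⟨σ :: L, by simp [hL], by simpa using ⟨h1, hs⟩, ?_⟩
    have hσ : σ * σ = 1 := Equiv.ext h1.1
    simp [hp, mul_assoc, hσ]

end RoutableOn

theorem Equiv.Perm.apply_mem_of_fix_outside {S : Finset V} {f : Perm V} (hf : ∀ v ∉ S, f v = v)
    {v : V} (hv : v ∈ S) : f v ∈ S := by
  by_contra h
  exact h ((f.injective (hf _ h)).symm ▸ hv)

/-- A spanning tree of the vertex set `S`, rooted at `r`, given by its parent and depth
functions (whose values are irrelevant outside `S`). -/
structure RootedSpanningTree (G : SimpleGraph V) (S : Finset V) (r : V) where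
  par : V → V
  dep : V → ℕ
  root_mem : r ∈ S
  dep_root : dep r = 0
  par_mem : ∀ {v}, v ∈ S → v ≠ r → par v ∈ S
  adj : ∀ {v}, v ∈ S → v ≠ r → G.Adj v (par v)
  dep_eq : ∀ {v}, v ∈ S → v ≠ r → dep v = dep (par v) + 1

namespace RootedSpanningTree

variable {S : Finset V} {r : V} (T : RootedSpanningTree G S r)

include T in
theorem induct {P : V → Prop} (h0 : ∀ v ∈ S, v ≠ r → T.par v = r → P v)
    (h1 : ∀ v ∈ S, v ≠ r → T.par v ≠ r → P (T.par v) → P v) : ∀ v ∈ S, v ≠ r → P v := by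
  intro v hv hr
  induction hd : T.dep v using Nat.strong_induction_on generalizing v with
  | _ d ih =>
    by_cases hp : T.par v = r
    · exact h0 v hv hr hp
    · exact h1 v hv hr hp
        (ih _ (by have := T.dep_eq hv hr; omega) _ (T.par_mem hv hr) hp rfl)

/-- The child of the root whose subtree contains `v` (and the root itself if `v` is the root). -/
def top (v : V) : V := T.par^[T.dep v - 1] v

/-- The sum of `s` over the ancestors of `v` other than `v` and the root. -/
def excess (s : V → ℤ) (v : V) : ℤ := ∑ k ∈ Finset.range (T.dep v - 1), s (T.par^[k + 1] v)

/-- The subtree consisting of the descendants of the child `c` of the root. -/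
noncomputable def branch (c : V) : Finset V := {v ∈ S | v ≠ r ∧ T.top v = c}

theorem dep_pos {v : V} (hv : v ∈ S) (hr : v ≠ r) : 0 < T.dep v := by
  have := T.dep_eq hv hr; omega

theorem dep_of_par {v : V} (hv : v ∈ S) (hr : v ≠ r) (hp : T.par v = r) : T.dep v = 1 := by
  rw [T.dep_eq hv hr, hp, T.dep_root]

theorem top_root : T.top r = r := by simp [top, T.dep_root]

theorem top_of_par {v : V} (hv : v ∈ S) (hr : v ≠ r) (hp : T.par v = r) : T.top v = v := by
  simp [top, T.dep_of_par hv hr hp]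

theorem top_par {v : V} (hv : v ∈ S) (hr : v ≠ r) (hp : T.par v ≠ r) :
    T.top (T.par v) = T.top v := by
  have h1 := T.dep_eq hv hr
  obtain ⟨d, hd⟩ := Nat.exists_eq_succ_of_ne_zero (T.dep_pos (T.par_mem hv hr) hp).ne'
  simp [top, h1, hd]

theorem excess_of_par (s : V → ℤ) {v : V} (hv : v ∈ S) (hr : v ≠ r) (hp : T.par v = r) :
    T.excess s v = 0 := by
  simp [excess, T.dep_of_par hv hr hp]

theorem excess_par (s : V → ℤ) {v : V} (hv : v ∈ S) (hr : v ≠ r) (hp : T.par v ≠ r) :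
    T.excess s v = T.excess s (T.par v) + s (T.par v) := by
  have h1 := T.dep_eq hv hr
  obtain ⟨d, hd⟩ := Nat.exists_eq_succ_of_ne_zero (T.dep_pos (T.par_mem hv hr) hp).ne'
  simp [excess, h1, hd, Finset.sum_range_succ']

theorem top_spec : ∀ v ∈ S, v ≠ r → T.top v ∈ S ∧ T.top v ≠ r ∧ T.par (T.top v) = r :=
  T.induct (fun v hv hr hp => by rw [T.top_of_par hv hr hp]; exact ⟨hv, hr, hp⟩)
    (fun v hv hr hp ih => by rwa [← T.top_par hv hr hp])

theorem top_eq_root_iff {v : V} (hv : v ∈ S) : T.top v = r ↔ v = r :=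
  ⟨fun h => by_contra fun hr => (T.top_spec v hv hr).2.1 h, fun h => h ▸ T.top_root⟩

/-- The relation `x → y` of edges along which a marked vertex `y` may move up to its parent `x`:
the parent is unmarked, and only `g` may move to the root. -/
def Active (imp : V → Prop) (g x y : V) : Prop :=
  y ∈ S ∧ y ≠ r ∧ T.par y = x ∧ imp y ∧ (x = r → y = g) ∧ (x ≠ r → ¬ imp x)

theorem exists_round (imp : V → Prop) (g : V) :
    ∃ σ : Perm V, IsMatchingStep G σ ∧ (∀ v ∉ S, σ v = v) ∧
      (∀ x y, T.Active imp g x y → ∃ y', T.Active imp g x y' ∧ σ x = y' ∧ σ y' = x) ∧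
      ∀ x, (∃ y, T.Active imp g x y ∧ σ x = y ∧ σ y = x) ∨
        (T.Active imp g (T.par x) x ∧ σ x = T.par x ∧ σ (T.par x) = x) ∨ σ x = x := by
  have hch : ∃ ch : V → V, ∀ x y, T.Active imp g x y → T.Active imp g x (ch x) :=
    ⟨fun x => if h : ∃ y, T.Active imp g x y then h.choose else x, fun x y hy => by
      have h : ∃ y, T.Active imp g x y := ⟨y, hy⟩
      simp only [dif_pos h]
      exact h.choose_spec⟩
  obtain ⟨ch, hch⟩ := hch
  have excl : ∀ {x y z}, T.Active imp g x y → ¬ T.Active imp g y z :=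
    fun h h' => h'.2.2.2.2.2 h.2.1 h.2.2.2.1
  let m : V → V := fun x => if T.Active imp g x (ch x) then ch x else
    if T.Active imp g (T.par x) x ∧ ch (T.par x) = x then T.par x else x
  have m1 : ∀ {x}, T.Active imp g x (ch x) → m x = ch x := fun h => if_pos h
  have m2 : ∀ {x}, T.Active imp g (T.par x) x → ch (T.par x) = x → m x = T.par x :=
    fun h h' => by simp only [m]; rw [if_neg (excl h), if_pos ⟨h, h'⟩]
  have key : ∀ x, (T.Active imp g x (ch x) ∧ m x = ch x ∧ m (ch x) = x) ∨
      (T.Active imp g (T.par x) x ∧ m x = T.par x ∧ m (T.par x) = x) ∨ m x = x := by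
    intro x
    by_cases h1 : T.Active imp g x (ch x)
    · have hp : T.par (ch x) = x := h1.2.2.1
      exact Or.inl ⟨h1, m1 h1, by rw [m2 (by rwa [hp]) (by rw [hp]), hp]⟩
    · by_cases h2 : T.Active imp g (T.par x) x ∧ ch (T.par x) = x
      · refine Or.inr (Or.inl ⟨h2.1, m2 h2.1 h2.2, ?_⟩)
        rw [m1 (by rw [h2.2]; exact h2.1), h2.2]
      · exact Or.inr (Or.inr (by simp only [m]; rw [if_neg h1, if_neg h2]))
  have inv : Function.Involutive m := fun x => by
    rcases key x with ⟨_, h, h'⟩ | ⟨_, h, h'⟩ | h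
    · rw [h, h']
    · rw [h, h']
    · rw [h, h]
  refine ⟨inv.toPerm, ⟨inv, fun v hv => ?_⟩, fun v hv => ?_, fun x y hxy => ?_, fun x => ?_⟩
  · change m v ≠ v at hv
    change G.Adj v (m v)
    rcases key v with ⟨h0, h, h'⟩ | ⟨h0, h, h'⟩ | h
    · rw [h]
      have := (T.adj h0.1 h0.2.1).symm
      rwa [h0.2.2.1] at this
    · rw [h]; exact T.adj h0.1 h0.2.1
    · exact (hv h).elim
  · change m v = v
    rcases key v with ⟨h0, h, h'⟩ | ⟨h0, h, h'⟩ | h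
    · have := T.par_mem h0.1 h0.2.1
      rw [h0.2.2.1] at this
      exact (hv this).elim
    · exact (hv h0.1).elim
    · exact h
  · have h := hch x y hxy
    rcases key x with ⟨h0, h1, h'⟩ | ⟨h0, _, _⟩ | h1
    · exact ⟨ch x, h0, h1, h'⟩
    · exact (excl h0 h).elim
    · have := m1 h
      rw [h1] at this
      rw [← this] at h
      exact (excl h h).elim
  · rcases key x with ⟨h0, h1, h'⟩ | h | h
    · exact Or.inl ⟨ch x, h0, h1, h'⟩
    · exact Or.inr (Or.inl h)
    · exact Or.inr (Or.inr h)

theorem excess_add_le {s s' δ : V → ℤ} (hδ0 : ∀ v, 0 ≤ δ v)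
    (hδ : ∀ v ∈ S, v ≠ r → T.par v ≠ r → δ (T.par v) = δ v)
    (h0 : ∀ v ∈ S, v ≠ r → T.par v = r → s' v ≤ s v + δ v)
    (h1 : ∀ v ∈ S, v ≠ r → T.par v ≠ r →
      s' v ≤ s v ∨ s' v + s' (T.par v) ≤ s v + s (T.par v)) :
    ∀ v ∈ S, v ≠ r → T.excess s' v + s' v ≤ T.excess s v + s v + δ v ∧
      T.excess s' v ≤ T.excess s v + δ v := by
  refine T.induct (fun v hv hr hp => ?_) (fun v hv hr hp ih => ?_)
  · rw [T.excess_of_par _ hv hr hp, T.excess_of_par _ hv hr hp]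
    have := h0 v hv hr hp
    have := hδ0 v
    constructor <;> linarith
  · rw [T.excess_par _ hv hr hp, T.excess_par _ hv hr hp]
    rw [hδ v hv hr hp] at ih
    rcases h1 v hv hr hp with h | h <;> constructor <;> linarith [ih.1, ih.2]

/-- The sign `-1` on marked vertices and `1` on unmarked ones. -/
noncomputable def sgn (imp : V → Prop) (v : V) : ℤ := if imp v then -1 else 1

theorem sgn_of {imp : V → Prop} {v : V} (h : imp v) : sgn imp v = -1 := if_pos h

theorem sgn_of_not {imp : V → Prop} {v : V} (h : ¬ imp v) : sgn imp v = 1 := if_neg h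

theorem sgn_le (imp : V → Prop) (v : V) : sgn imp v ≤ 1 := by
  unfold sgn; split_ifs <;> simp

theorem excess_round {imp imp' : V → Prop} {g : V} {σ : Perm V}
    (hact : ∀ x y, T.Active imp g x y → ∃ y', T.Active imp g x y' ∧ σ x = y' ∧ σ y' = x)
    (hcase : ∀ x, (∃ y, T.Active imp g x y ∧ σ x = y ∧ σ y = x) ∨
        (T.Active imp g (T.par x) x ∧ σ x = T.par x ∧ σ (T.par x) = x) ∨ σ x = x)
    (hup : ∀ x y, x ≠ r → T.Active imp g x y → σ x = y → imp' x)
    (hdown : ∀ x, T.par x ≠ r → T.Active imp g (T.par x) x → σ x = T.par x → ¬ imp' x)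
    (hfix : ∀ x, σ x = x → (imp' x ↔ imp x))
    {v : V} (hv : v ∈ S) (hr : v ≠ r) (hp : T.par v ≠ r) (himp : imp' v) {b : ℤ}
    (hb : ∀ u ∈ S, u ≠ r → T.top u = T.top v → imp u → T.excess (sgn imp) u ≤ b) :
    T.excess (sgn imp') v ≤ b - 1 + if imp g ∧ T.top v = g then 2 else 0 := by
  have main := T.excess_add_le (s := sgn imp) (s' := sgn imp')
    (δ := fun v => if imp g ∧ T.top v = g then 2 else 0)
    (fun v => by split_ifs <;> simp)
    (fun v hv hr hp => by rw [T.top_par hv hr hp])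
    (fun v hv hr hp => by
      rcases hcase v with ⟨y, h1, h2, h3⟩ | ⟨h1, h2, h3⟩ | h
      · rw [sgn_of (hup v y hr h1 h2), sgn_of_not (h1.2.2.2.2.2 hr)]
        split_ifs <;> simp
      · have hg := h1.2.2.2.2.1 hp
        have himp := h1.2.2.2.1
        rw [if_pos ⟨hg ▸ himp, by rw [T.top_of_par hv hr hp]; exact hg⟩, sgn_of himp]
        have := sgn_le imp' v
        linarith
      · simp only [sgn, hfix v h]
        split_ifs <;> simp)
    (fun v hv hr hp => by
      rcases hcase v with ⟨y, h1, h2, h3⟩ | ⟨h1, h2, h3⟩ | h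
      · left
        rw [sgn_of (hup v y hr h1 h2), sgn_of_not (h1.2.2.2.2.2 hr)]; simp
      · right
        rw [sgn_of (hup _ v hp h1 h3), sgn_of_not (hdown v hp h1 h2), sgn_of h1.2.2.2.1,
          sgn_of_not (h1.2.2.2.2.2 hp)]
        simp
      · left
        simp only [sgn, hfix v h]; rfl)
  set δ : V → ℤ := fun v => if imp g ∧ T.top v = g then 2 else 0 with hδ
  change _ ≤ b - 1 + δ v
  have hw := T.par_mem hv hr
  have hδw : δ (T.par v) = δ v := by simp only [hδ, T.top_par hv hr hp]
  have hle := (main v hv hr).2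
  have hlew := (main _ hw hp).2
  have e1 := T.excess_par (sgn imp) hv hr hp
  have e2 := T.excess_par (sgn imp') hv hr hp
  by_cases hi : imp v
  · have hbv := hb v hv hr rfl hi
    by_cases hiw : imp (T.par v)
    · have := hb _ hw hp (T.top_par hv hr hp) hiw
      rw [sgn_of hiw] at e1
      linarith
    · obtain ⟨y, h1, h2, h3⟩ := hact _ v ⟨hv, hr, rfl, hi, fun h => (hp h).elim, fun _ => hiw⟩
      rw [sgn_of_not hiw] at e1
      rw [sgn_of (hup _ y hp h1 h2)] at e2
      linarith
  · rcases hcase v with ⟨y, h1, h2, h3⟩ | ⟨h1, _, _⟩ | h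
    · obtain ⟨hy, hyr, rfl, hyi, -, -⟩ := h1
      have e3 := T.excess_par (sgn imp) hy hyr hr
      rw [sgn_of_not hi] at e3
      have := hb y hy hyr (T.top_par hy hyr hr).symm hyi
      linarith
    · exact (hi h1.2.2.2.1).elim
    · exact (hi ((hfix v h).1 himp)).elim

theorem exists_one_le_excess {imp : V → Prop} {g : V} (hg : ¬ imp g) {y : V} (hy : y ∈ S)
    (hyr : y ≠ r) (hyg : T.top y = g) (hyi : imp y) :
    ∃ u ∈ S, u ≠ r ∧ T.top u = g ∧ imp u ∧ 1 ≤ T.excess (sgn imp) u := by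
  by_contra! hcon
  have : ∀ v ∈ S, v ≠ r → T.top v = g → ¬ imp v ∧ 0 ≤ T.excess (sgn imp) v := by
    refine T.induct (fun v hv hr hp ht => ?_) (fun v hv hr hp ih ht => ?_)
    · rw [T.top_of_par hv hr hp] at ht
      exact ⟨ht ▸ hg, (T.excess_of_par _ hv hr hp).ge⟩
    · obtain ⟨h1, h2⟩ := ih (by rw [T.top_par hv hr hp, ht])
      have e := T.excess_par (sgn imp) hv hr hp
      rw [sgn_of_not h1] at e
      exact ⟨fun hi => by have := hcon v hv hr ht hi; linarith, by linarith⟩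
  exact (this y hy hyr hyg).1 hyi

theorem excess_le_card (imp : V → Prop) : ∀ v ∈ S, v ≠ r →
    T.excess (sgn imp) v ≤ ({w ∈ S | (w ≠ r ∧ ¬ imp w) ∧ T.dep w < T.dep v} : Finset V).card := by
  refine T.induct (fun v hv hr hp => ?_) (fun v hv hr hp ih => ?_)
  · rw [T.excess_of_par _ hv hr hp]; positivity
  · rw [T.excess_par _ hv hr hp]
    have hd := T.dep_eq hv hr
    by_cases hi : imp (T.par v)
    · rw [sgn_of hi]
      have : ({w ∈ S | (w ≠ r ∧ ¬ imp w) ∧ T.dep w < T.dep (T.par v)} : Finset V).card ≤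
          ({w ∈ S | (w ≠ r ∧ ¬ imp w) ∧ T.dep w < T.dep v} : Finset V).card :=
        Finset.card_le_card (Finset.monotone_filter_right _ fun w _ hw => ⟨hw.1, by omega⟩)
      have : (_ : ℤ) ≤ _ := Int.ofNat_le.2 this
      linarith
    · rw [sgn_of_not hi]
      have : ({w ∈ S | (w ≠ r ∧ ¬ imp w) ∧ T.dep w < T.dep (T.par v)} : Finset V).card <
          ({w ∈ S | (w ≠ r ∧ ¬ imp w) ∧ T.dep w < T.dep v} : Finset V).card := by
        refine Finset.card_lt_card ((Finset.ssubset_iff_of_subset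
          (Finset.monotone_filter_right _ fun w _ hw => ⟨hw.1, by omega⟩)).2 ⟨T.par v, ?_, ?_⟩)
        · simp only [Finset.mem_filter]
          exact ⟨T.par_mem hv hr, ⟨hp, hi⟩, by omega⟩
        · simp
      have : (_ : ℤ) < _ := Int.ofNat_lt.2 this
      linarith

theorem excess_le_card_of_forall_mem (imp : V → Prop) {P : Finset V}
    (hP : ∀ w ∈ S, w ≠ r → ¬ imp w → w ∈ P) {v : V} (hv : v ∈ S) (hr : v ≠ r) :
    T.excess (sgn imp) v ≤ P.card :=
  (T.excess_le_card imp v hv hr).trans (Int.ofNat_le.2 (Finset.card_le_card fun w hw => by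
    have h := Finset.mem_filter.1 hw
    exact hP w h.1 h.2.1.1 h.2.1.2))

theorem exists_apply_top_ne {f : Perm V} (hf : ∀ v ∉ S, f v = v) {h x : V} (hx : x ∈ S)
    (hxh : T.top x ≠ h) (hfx : T.top (f x) = h) : ∃ y ∈ S, T.top y = h ∧ T.top (f y) ≠ h := by
  by_contra! hcon
  obtain ⟨y, hy, hyx⟩ := Finset.surj_on_of_inj_on_of_card_le (s := {v ∈ S | T.top v = h})
    (t := {v ∈ S | T.top v = h}) (fun v _ => f v)
    (fun v hv => by
      rw [Finset.mem_filter] at hv ⊢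
      exact ⟨Perm.apply_mem_of_fix_outside hf hv.1, hcon v hv.1 hv.2⟩)
    (fun _ _ _ _ e => f.injective e) le_rfl (f x)
    (Finset.mem_filter.2 ⟨Perm.apply_mem_of_fix_outside hf hx, hfx⟩)
  obtain rfl := f.injective hyx
  exact hxh (Finset.mem_filter.1 hy).2

/-- The child `g` of the root is a branch with which the root may exchange pebbles: the pebble
at the root either belongs to the branch of `g` or to the root itself, and some pebble in the
branch of `g` belongs elsewhere. -/
structure IsTarget (f : Perm V) (g : V) : Prop where
  mem : g ∈ S
  ne_root : g ≠ r
  par_eq : T.par g = r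
  root : f r = r ∨ T.top (f r) = g
  exists_ne : ∃ y ∈ S, T.top y = g ∧ T.top (f y) ≠ g

theorem exists_isTarget {f : Perm V} (hf : ∀ v ∉ S, f v = v) {j : V}
    (hj : f r ≠ r → T.top (f r) ≠ j) :
    (∀ v ∈ S, T.top (f v) = T.top v) ∨ ∃ g, g ≠ j ∧ T.IsTarget f g := by
  have mem : ∀ {v}, v ∈ S → f v ∈ S := Perm.apply_mem_of_fix_outside hf
  by_cases hr : f r = r
  · rw [or_iff_not_imp_left]
    intro hcon
    push Not at hcon
    obtain ⟨x, hx, hxt⟩ := hcon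
    have hxr : x ≠ r := by rintro rfl; exact hxt (by rw [hr])
    have hfxr : f x ≠ r := fun h => hxr (f.injective (h.trans hr.symm))
    have hA : T.IsTarget f (T.top x) :=
      let ⟨h1, h2, h3⟩ := T.top_spec x hx hxr
      ⟨h1, h2, h3, Or.inl hr, x, hx, rfl, hxt⟩
    have hB : T.IsTarget f (T.top (f x)) :=
      let ⟨h1, h2, h3⟩ := T.top_spec (f x) (mem hx) hfxr
      ⟨h1, h2, h3, Or.inl hr, T.exists_apply_top_ne hf hx hxt.symm rfl⟩
    by_cases h : T.top x = j
    · exact ⟨_, h ▸ hxt, hB⟩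
    · exact ⟨_, h, hA⟩
  · obtain ⟨h1, h2, h3⟩ := T.top_spec (f r) (mem T.root_mem) hr
    refine Or.inr ⟨_, hj hr, h1, h2, h3, Or.inr rfl, ?_⟩
    exact T.exists_apply_top_ne hf T.root_mem (by rw [T.top_root]; exact h2.symm) rfl

/-- The positions of the pebbles, other than the one belonging to the root, that are not in
their destination branch. -/
noncomputable def misplaced (f : Perm V) : Finset V := {x ∈ S | f x ≠ r ∧ T.top (f x) ≠ T.top x}

theorem routableOn_of_potential {m : ℕ}
    (H : ∀ f : Perm V, (∀ v ∉ S, f v = v) → (∀ v ∈ S, T.top (f v) = T.top v) →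
      RoutableOn G S m f) (k : ℕ) : ∀ (N B : ℕ) (f : Perm V) (g : V), N + B ≤ k →
      (∀ v ∉ S, f v = v) → T.IsTarget f g → 1 ≤ B →
      (∀ v ∈ S, v ≠ r → T.top (f v) ≠ T.top v →
        T.excess (sgn fun x => T.top (f x) ≠ T.top x) v + (if T.top v = g then 1 else 0) ≤ B) →
      (f r = r → 3 * (T.misplaced f).card ≤ 2 * N) →
      (f r ≠ r → 3 * (T.misplaced f).card ≤ 2 * N + 1 ∨
        3 * (T.misplaced f).card ≤ 2 * N + 2 ∧ ∀ x ∈ S, f x = r → T.top x ≠ g) →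
      RoutableOn G S (k + m) f := by
  induction k with
  | zero => intro N B f g h1 _ _ h2; omega
  | succ k ih =>
    intro N B f g hk hf hg hB hex hc1 hc2
    obtain ⟨σ, hσ, hσS, hact, hcase⟩ := T.exists_round (fun x => T.top (f x) ≠ T.top x) g
    have hf' : ∀ v ∉ S, (f * σ) v = v := fun v hv => by
      rw [Perm.mul_apply, hσS v hv, hf v hv]
    have mem : ∀ {v}, v ∈ S → f v ∈ S := Perm.apply_mem_of_fix_outside hf
    have memσ : ∀ {v}, v ∈ S → σ v ∈ S := Perm.apply_mem_of_fix_outside hσS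
    rw [Nat.add_right_comm]
    refine ⟨σ, hσ, hσS, ?_⟩
    have hgt : T.top g = g := T.top_of_par hg.mem hg.ne_root hg.par_eq
    have hgr : f r = r ∨ T.top (f r) = g := hg.root
    have tpar : ∀ {y}, T.Active (fun x => T.top (f x) ≠ T.top x) g (T.par y) y → T.par y ≠ r →
        T.top (T.par y) = T.top y := fun h hp => T.top_par h.1 h.2.1 hp
    have hup : ∀ x y, x ≠ r → T.Active (fun x => T.top (f x) ≠ T.top x) g x y → σ x = y →
        T.top ((f * σ) x) ≠ T.top x := by
      rintro x y hx ⟨h1, h2, rfl, h4, h5, h6⟩ h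
      rw [Perm.mul_apply, h, T.top_par h1 h2 hx]
      exact h4
    have hdown : ∀ x, T.par x ≠ r → T.Active (fun x => T.top (f x) ≠ T.top x) g (T.par x) x →
        σ x = T.par x → ¬ T.top ((f * σ) x) ≠ T.top x := by
      intro x hx ha h
      have := ha.2.2.2.2.2 hx
      rwa [Perm.mul_apply, h, ← tpar ha hx]
    have hfix : ∀ x, σ x = x → (T.top ((f * σ) x) ≠ T.top x ↔ T.top (f x) ≠ T.top x) := by
      intro x h
      rw [Perm.mul_apply, h]
    have hround := fun {v} (hv : v ∈ S) hr hp himp {b} hb =>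
      T.excess_round hact hcase hup hdown hfix (v := v) hv hr hp himp (b := b) hb
    have topσ : ∀ x, x ≠ r → σ x ≠ r → T.top (σ x) = T.top x := by
      intro x hx hσx
      rcases hcase x with ⟨y, h1, h2, h3⟩ | ⟨h1, h2, h3⟩ | h
      · rw [h2]
        obtain ⟨hy, hyr, rfl, -⟩ := h1
        exact (T.top_par hy hyr hx).symm
      · rw [h2]
        rw [h2] at hσx
        exact T.top_par h1.1 h1.2.1 hσx
      · rw [h]
    have hcard : ∀ A : Finset V, (∀ x ∈ T.misplaced (f * σ), σ x ∈ A) →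
        (T.misplaced (f * σ)).card ≤ A.card := fun A hA =>
      Finset.card_le_card_of_injOn σ hA σ.injective.injOn
    have mem_mis : ∀ {f : Perm V} {x}, x ∈ T.misplaced f ↔
        x ∈ S ∧ f x ≠ r ∧ T.top (f x) ≠ T.top x := by
      intro f x; simp [misplaced]
    by_cases hgi : T.top (f g) = T.top g
    · have hσr : σ r = r := by
        rcases hcase r with ⟨y, h1, h2, h3⟩ | ⟨h1, h2, h3⟩ | h
        · exact (h1.2.2.2.1 (by rw [h1.2.2.2.2.1 rfl]; exact hgi)).elim
        · exact (h1.2.1 rfl).elim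
        · exact h
      have topσ' : ∀ x, T.top (σ x) = T.top x := fun x => by
        by_cases hx : x = r
        · rw [hx, hσr]
        · exact topσ x hx fun h => hx (σ.injective (h.trans hσr.symm))
      have hfr : (f * σ) r = f r := by rw [Perm.mul_apply, hσr]
      have hB2 : 2 ≤ B := by
        obtain ⟨y, hy, hyg, hyf⟩ := hg.exists_ne
        have hyr : y ≠ r := by rintro rfl; rw [T.top_root] at hyg; exact hg.ne_root hyg.symm
        obtain ⟨u, hu, hur, hut, hui, h1⟩ := T.exists_one_le_excess
          (imp := fun x => T.top (f x) ≠ T.top x) (g := g) (by simpa using hgi) hy hyr hyg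
          (by rw [hyg]; exact hyf)
        have := hex u hu hur hui
        rw [if_pos hut] at this
        have : (2 : ℤ) ≤ B := by linarith
        exact_mod_cast this
      have hu : (T.misplaced (f * σ)).card ≤ (T.misplaced f).card := hcard _ fun x hx => by
        rw [mem_mis] at hx ⊢
        rw [topσ']
        exact ⟨memσ hx.1, hx.2⟩
      refine ih N (B - 1) (f * σ) g (by omega) hf' ⟨hg.mem, hg.ne_root, hg.par_eq, ?_, ?_⟩
        (by omega) ?_ ?_ ?_
      · rwa [hfr]
      · obtain ⟨y, hy, hyg, hyf⟩ := hg.exists_ne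
        refine ⟨σ.symm y, ?_, ?_, by rwa [Perm.mul_apply, Equiv.apply_symm_apply]⟩
        · by_contra h
          have := hσS _ h
          rw [Equiv.apply_symm_apply] at this
          exact h (this ▸ hy)
        · rw [← topσ', Equiv.apply_symm_apply, hyg]
      · intro v hv hr hi
        have hBc : ((B - 1 : ℕ) : ℤ) = B - 1 := by push_cast [hB]; rfl
        rw [hBc]
        by_cases hp : T.par v = r
        · rw [T.excess_of_par _ hv hr hp]
          have : (2 : ℤ) ≤ B := by exact_mod_cast hB2
          split_ifs <;> linarith
        · have := hround hv hr hp hi (b := B - if T.top v = g then 1 else 0)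
            (fun u hu hur hut hui => by
              have := hex u hu hur hui
              rw [hut] at this
              linarith)
          rw [if_neg (show ¬ (T.top (f g) ≠ T.top g ∧ T.top v = g) from fun h => h.1 hgi)] at this
          linarith
      · intro h
        rw [hfr] at h
        have := hc1 h
        omega
      · intro h
        rw [hfr] at h
        rcases hc2 h with h | ⟨h, h'⟩
        · left; omega
        · refine Or.inr ⟨by omega, fun x hx hfx => ?_⟩
          rw [← topσ']
          exact h' _ (memσ hx) hfx
    · obtain ⟨hσr, hσg⟩ : σ r = g ∧ σ g = r := by
        obtain ⟨y, h1, h2, h3⟩ := hact r g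
          ⟨hg.mem, hg.ne_root, hg.par_eq, hgi, fun _ => rfl, fun h => (h rfl).elim⟩
        obtain rfl := h1.2.2.2.2.1 rfl
        exact ⟨h2, h3⟩
      have hfr : (f * σ) r = f g := by rw [Perm.mul_apply, hσr]
      rcases T.exists_isTarget hf' (j := g)
          (fun _ => by rw [hfr]; exact fun h => hgi (h.trans hgt.symm)) with
        hdone | ⟨g', hgg', hg'⟩
      · exact (H _ hf' hdone).mono (by omega)
      have hu : (T.misplaced (f * σ)).card ≤ ((T.misplaced f).erase r).card :=
        hcard _ fun x hx => by
          rw [mem_mis] at hx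
          obtain ⟨hxS, hx1, hx2⟩ := hx
          rw [Perm.mul_apply] at hx1 hx2
          have hσx : σ x ≠ r := by
            intro h
            have hxg : x = g := σ.injective (h.trans hσg.symm)
            rw [h] at hx1 hx2
            rcases hgr with h' | h'
            · exact hx1 h'
            · exact hx2 (by rw [h', hxg, hgt])
          rw [Finset.mem_erase, mem_mis]
          refine ⟨hσx, memσ hxS, hx1, ?_⟩
          by_cases hxr : x = r
          · rw [hxr, hσr]; exact hgi
          · rwa [topσ x hxr hσx]
      have hpos : 1 ≤ N := by
        have : 0 < (T.misplaced f).card := by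
          rw [Finset.card_pos]
          by_cases h : f r = r
          · exact ⟨g, mem_mis.2 ⟨hg.mem, fun h' => hg.ne_root (f.injective (h'.trans h.symm)),
              hgi⟩⟩
          · refine ⟨r, mem_mis.2 ⟨T.root_mem, h, ?_⟩⟩
            rw [T.top_root]
            exact fun h' => h ((T.top_eq_root_iff (mem T.root_mem)).1 h')
        by_cases h : f r = r
        · have := hc1 h; omega
        · have := hc2 h; omega
      have hgr' : f r ≠ r → ((T.misplaced f).erase r).card + 1 = (T.misplaced f).card := by
        intro h
        refine Finset.card_erase_add_one (mem_mis.2 ⟨T.root_mem, h, ?_⟩)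
        rw [T.top_root]
        exact fun h' => h ((T.top_eq_root_iff (mem T.root_mem)).1 h')
      have hle := Finset.card_erase_le (s := T.misplaced f) (a := r)
      refine ih (N - 1) B (f * σ) g' (by omega) hf' hg' hB ?_ ?_ ?_
      · intro v hv hr hi
        have hB' : (1 : ℤ) ≤ B := by exact_mod_cast hB
        by_cases hp : T.par v = r
        · rw [T.excess_of_par _ hv hr hp]
          split_ifs <;> linarith
        · have := hround hv hr hp hi (b := B - if T.top v = g then 1 else 0)
            (fun u hu hur hut hui => by
              have := hex u hu hur hui
              rw [hut] at this
              linarith)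
          by_cases hvg : T.top v = g
          · rw [if_pos hvg, if_pos ⟨hgi, hvg⟩] at this
            rw [if_neg (by rw [hvg]; exact hgg'.symm)]
            linarith
          · rw [if_neg hvg, if_neg fun h => hvg h.2] at this
            split_ifs <;> linarith
      · intro h
        rw [hfr] at h
        have hfr' : f r ≠ r := fun h' => hg.ne_root (f.injective (h.trans h'.symm))
        have := hgr' hfr'
        rcases hc2 hfr' with h' | ⟨_, h'⟩
        · omega
        · exact (h' g hg.mem h hgt).elim
      · intro h
        by_cases hfr' : f r = r
        · have := hc1 hfr'
          refine Or.inr ⟨by omega, fun x hx hfx => ?_⟩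
          have : σ x = σ g := by
            rw [hσg]; exact f.injective (hfx.trans hfr'.symm)
          rw [σ.injective this, hgt]
          exact hgg'.symm
        · have := hgr' hfr'
          left
          rcases hc2 hfr' with h' | h' <;> omega

theorem routableOn_of_preserving {m : ℕ}
    (H : ∀ f : Perm V, (∀ v ∉ S, f v = v) → (∀ v ∈ S, T.top (f v) = T.top v) →
      RoutableOn G S m f) {k : ℕ} (hk : 3 * S.card ≤ 2 * k + 1) (f : Perm V)
    (hf : ∀ v ∉ S, f v = v) : RoutableOn G S (k + m) f := by
  rcases T.exists_isTarget hf (j := r) (fun h h' => h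
    ((T.top_eq_root_iff (Perm.apply_mem_of_fix_outside hf T.root_mem)).1 h')) with
    hdone | ⟨g, -, hg⟩
  · exact (H f hf hdone).mono (by omega)
  set P : Finset V := {w ∈ S | w ≠ r ∧ ¬ T.top (f w) ≠ T.top w} with hP
  have hcard : (T.misplaced f).card + P.card + 1 ≤ S.card := by
    have hd : Disjoint (T.misplaced f) P := by
      rw [Finset.disjoint_left]
      intro x hx hx'
      simp only [misplaced, hP, Finset.mem_filter] at hx hx'
      exact hx'.2.2 hx.2.2
    rw [← Finset.card_union_of_disjoint hd, Nat.succ_le_iff]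
    refine Finset.card_lt_card ((Finset.ssubset_iff_of_subset (Finset.union_subset
      (Finset.filter_subset _ _) (Finset.filter_subset _ _))).2 ⟨f.symm r, ?_, ?_⟩)
    · by_contra h
      have := hf _ h
      rw [Equiv.apply_symm_apply] at this
      exact h (this ▸ T.root_mem)
    · intro h
      rcases Finset.mem_union.1 h with h | h
      · exact (Finset.mem_filter.1 h).2.1 (f.apply_symm_apply r)
      · have h' := Finset.mem_filter.1 h
        have := not_not.1 h'.2.2
        rw [Equiv.apply_symm_apply, T.top_root] at this
        exact h'.2.1 ((T.top_eq_root_iff h'.1).1 this.symm)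
  refine T.routableOn_of_potential H k ((3 * (T.misplaced f).card + 1) / 2) (P.card + 1) f g
    (by omega) hf hg (by omega) (fun v hv hr hi => ?_) (fun _ => by omega)
    (fun _ => Or.inl (by omega))
  have h1 := T.excess_le_card_of_forall_mem (fun x => T.top (f x) ≠ T.top x) (P := P)
    (fun w hw hwr hwi => Finset.mem_filter.2 ⟨hw, hwr, hwi⟩) hv hr
  push_cast
  split_ifs <;> linarith

theorem mem_branch {c v : V} : v ∈ T.branch c ↔ v ∈ S ∧ v ≠ r ∧ T.top v = c := by
  simp [branch]

/-- The subtree below a child `c` of the root, rooted at `c`. -/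
noncomputable def branchTree {c : V} (hc : c ∈ S) (hcr : c ≠ r) (hp : T.par c = r) :
    RootedSpanningTree G (T.branch c) c where
  par := T.par
  dep v := T.dep v - 1
  root_mem := T.mem_branch.2 ⟨hc, hcr, T.top_of_par hc hcr hp⟩
  dep_root := by rw [T.dep_of_par hc hcr hp]
  par_mem {v} hv hvc := by
    obtain ⟨h1, h2, h3⟩ := T.mem_branch.1 hv
    have hpv : T.par v ≠ r := fun h => hvc (by rw [← h3, T.top_of_par h1 h2 h])
    exact T.mem_branch.2 ⟨T.par_mem h1 h2, hpv, by rw [T.top_par h1 h2 hpv, h3]⟩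
  adj hv _ := T.adj (T.mem_branch.1 hv).1 (T.mem_branch.1 hv).2.1
  dep_eq {v} hv hvc := by
    obtain ⟨h1, h2, h3⟩ := T.mem_branch.1 hv
    have hpv : T.par v ≠ r := fun h => hvc (by rw [← h3, T.top_of_par h1 h2 h])
    have := T.dep_eq h1 h2
    have := T.dep_pos (T.par_mem h1 h2) hpv
    omega

/-- The tree rerooted at a child `c` of the root. -/
noncomputable def reroot {c : V} (hc : c ∈ S) (hcr : c ≠ r) (hp : T.par c = r) :
    RootedSpanningTree G S c where
  par v := if v = r then c else T.par v
  dep v := if v ∈ T.branch c then T.dep v - 1 else T.dep v + 1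
  root_mem := hc
  dep_root := by
    rw [if_pos (T.mem_branch.2 ⟨hc, hcr, T.top_of_par hc hcr hp⟩), T.dep_of_par hc hcr hp]
  par_mem {v} hv hvc := by
    split_ifs with h
    · exact hc
    · exact T.par_mem hv h
  adj {v} hv hvc := by
    split_ifs with h
    · rw [h, ← hp]; exact (T.adj hc hcr).symm
    · exact T.adj hv h
  dep_eq {v} hv hvc := by
    have hcb : c ∈ T.branch c := T.mem_branch.2 ⟨hc, hcr, T.top_of_par hc hcr hp⟩
    have hrb : r ∉ T.branch c := fun h => (T.mem_branch.1 h).2.1 rfl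
    by_cases h : v = r
    · rw [if_pos h, h, if_neg hrb, if_pos hcb, T.dep_root, T.dep_of_par hc hcr hp]
    · rw [if_neg h]
      have hd := T.dep_eq hv h
      by_cases hpv : T.par v = r
      · rw [hpv, if_neg hrb, if_neg, hd, hpv]
        exact fun hb => hvc (by rw [← (T.mem_branch.1 hb).2.2, T.top_of_par hv h hpv])
      · have := T.dep_pos (T.par_mem hv h) hpv
        have hb : v ∈ T.branch c ↔ T.par v ∈ T.branch c := by
          simp [T.mem_branch, T.top_par hv h hpv, hv, h, hpv, T.par_mem hv h]
        by_cases hvb : v ∈ T.branch c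
        · rw [if_pos hvb, if_pos (hb.1 hvb)]; omega
        · rw [if_neg hvb, if_neg fun h => hvb (hb.2 h)]; omega

theorem sum_dep_reroot {c : V} (hc : c ∈ S) (hcr : c ≠ r) (hp : T.par c = r) :
    ∑ v ∈ S, (T.reroot hc hcr hp).dep v + 2 * (T.branch c).card = ∑ v ∈ S, T.dep v + S.card := by
  have hsub : T.branch c ⊆ S := Finset.filter_subset _ _
  have h2 : 2 * (T.branch c).card = ∑ v ∈ S, if v ∈ T.branch c then 2 else 0 := by
    rw [Finset.sum_ite_mem, Finset.inter_eq_right.2 hsub, Finset.sum_const, smul_eq_mul, mul_comm]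
  rw [h2, ← Finset.sum_add_distrib, Finset.card_eq_sum_ones, ← Finset.sum_add_distrib]
  refine Finset.sum_congr rfl fun v hv => ?_
  by_cases hb : v ∈ T.branch c
  · have := T.dep_pos hv (T.mem_branch.1 hb).2.1
    simp only [reroot, if_pos hb]
    omega
  · simp only [reroot, if_neg hb]

include T in
theorem exists_centroid : ∃ (r' : V) (T' : RootedSpanningTree G S r'),
    ∀ c ∈ S, c ≠ r' → T'.par c = r' → 2 * (T'.branch c).card ≤ S.card := by
  induction hd : ∑ v ∈ S, T.dep v using Nat.strong_induction_on generalizing r with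
  | _ d ih =>
    by_cases h : ∀ c ∈ S, c ≠ r → T.par c = r → 2 * (T.branch c).card ≤ S.card
    · exact ⟨r, T, h⟩
    · push Not at h
      obtain ⟨c, hc, hcr, hp, h⟩ := h
      have := T.sum_dep_reroot hc hcr hp
      exact ih _ (by omega) (T.reroot hc hcr hp) rfl

theorem routableOn_of_branches {m : ℕ}
    (H : ∀ c ∈ S, c ≠ r → T.par c = r → ∀ f : Perm V, (∀ v ∉ T.branch c, f v = v) →
      RoutableOn G (T.branch c) m f) (f : Perm V)
    (hf : ∀ v ∉ S, f v = v) (ht : ∀ v ∈ S, T.top (f v) = T.top v) : RoutableOn G S m f := by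
  suffices h : ∀ (A : Finset V) (f : Perm V), (∀ v ∈ S, T.top (f v) = T.top v) →
      (∀ v ∉ A.biUnion T.branch, f v = v) → RoutableOn G (A.biUnion T.branch) m f by
    refine (h (S.image T.top) f ht fun v hv => ?_).mono_set
      (Finset.biUnion_subset.2 fun c _ => Finset.filter_subset _ _)
    by_cases hvS : v ∈ S
    · by_cases hvr : v = r
      · rw [hvr, ← T.top_eq_root_iff (Perm.apply_mem_of_fix_outside hf T.root_mem),
          ht r T.root_mem, T.top_root]
      · exact (hv (Finset.mem_biUnion.2 ⟨T.top v, Finset.mem_image_of_mem _ hvS,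
          T.mem_branch.2 ⟨hvS, hvr, rfl⟩⟩)).elim
    · exact hf v hvS
  intro A
  induction A using Finset.induction_on with
  | empty =>
    intro f _ hf
    obtain rfl : f = 1 := Equiv.ext fun v => hf v (by simp)
    exact RoutableOn.one _ _
  | insert c A hc ih =>
    intro f ht hf
    rw [Finset.biUnion_insert] at hf ⊢
    have hsub : T.branch c ∪ A.biUnion T.branch ⊆ S :=
      Finset.union_subset (Finset.filter_subset _ _)
        (Finset.biUnion_subset.2 fun c _ => Finset.filter_subset _ _)
    have hmem : ∀ {v}, v ∈ T.branch c → f v ∈ T.branch c := by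
      intro v hv
      obtain ⟨h1, h2, h3⟩ := T.mem_branch.1 hv
      have hfv := Perm.apply_mem_of_fix_outside hf (Finset.mem_union_left _ hv)
      refine T.mem_branch.2 ⟨hsub hfv, ?_, by rw [ht v h1, h3]⟩
      rintro h
      have := ht v h1
      rw [h, T.top_root] at this
      exact h2 ((T.top_eq_root_iff h1).1 this.symm)
    have hdisj : Disjoint (T.branch c) (A.biUnion T.branch) := by
      rw [Finset.disjoint_biUnion_right]
      intro c' hc'
      rw [Finset.disjoint_left]
      intro v hv hv'
      have := (T.mem_branch.1 hv).2.2.symm.trans (T.mem_branch.1 hv').2.2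
      exact hc (this ▸ hc')
    have hiff : ∀ v, f v ∈ T.branch c ↔ v ∈ T.branch c := by
      refine fun v => ⟨fun h => ?_, hmem⟩
      obtain ⟨w, hw, hwv⟩ := Finset.surj_on_of_inj_on_of_card_le (s := T.branch c)
        (t := T.branch c) (fun v _ => f v) (fun v hv => hmem hv)
        (fun _ _ _ _ e => f.injective e) le_rfl (f v) h
      exact f.injective hwv ▸ hw
    set f₁ : Perm V := Perm.ofSubtype (f.subtypePerm hiff) with hf₁
    have h₁ : ∀ v ∈ T.branch c, f₁ v = f v := fun v hv => by
      rw [hf₁, Perm.ofSubtype_apply_of_mem _ hv, Perm.subtypePerm_apply]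
    have h₁' : ∀ v ∉ T.branch c, f₁ v = v := fun v hv =>
      Perm.ofSubtype_apply_of_not_mem _ hv
    have h₂ : ∀ v ∈ T.branch c, (f₁⁻¹ * f) v = v := fun v hv => by
      rw [Perm.mul_apply, ← h₁ v hv, Perm.inv_eq_iff_eq]
    have h₂' : ∀ v ∉ T.branch c, (f₁⁻¹ * f) v = f v := fun v hv => by
      rw [Perm.mul_apply, Perm.inv_eq_iff_eq, h₁' _ fun h => hv ((hiff v).1 h)]
    have := RoutableOn.mul_of_disjoint hdisj (k := m) (f := f₁) (f' := f₁⁻¹ * f) ?_ (ih _ ?_ ?_)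
    · rwa [mul_inv_cancel_left] at this
    · by_cases hb : ∃ v, v ∈ T.branch c
      · obtain ⟨v, hv⟩ := hb
        obtain ⟨h1, h2, rfl⟩ := T.mem_branch.1 hv
        obtain ⟨h3, h4, h5⟩ := T.top_spec v h1 h2
        exact H _ h3 h4 h5 f₁ h₁'
      · obtain h : f₁ = 1 := Equiv.ext fun v => h₁' v fun h => hb ⟨v, h⟩
        rw [h]
        exact RoutableOn.one _ _
    · intro v hv
      by_cases hb : v ∈ T.branch c
      · rw [h₂ v hb]
      · rw [h₂' v hb, ht v hv]
    · intro v hv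
      by_cases hb : v ∈ T.branch c
      · exact h₂ v hb
      · rw [h₂' v hb]
        exact hf v (by rw [Finset.mem_union]; exact not_or.2 ⟨hb, hv⟩)

include T in
theorem routableOn (f : Perm V) (hf : ∀ v ∉ S, f v = v) : RoutableOn G S (3 * S.card) f := by
  induction hn : S.card using Nat.strong_induction_on generalizing S r f with
  | _ n ih =>
    obtain ⟨r', T', hT'⟩ := T.exists_centroid
    refine (T'.routableOn_of_preserving (m := 3 * (n / 2)) (k := 3 * n / 2)
      (T'.routableOn_of_branches fun c hc hcr hp f hf => ?_) (by omega) f hf).mono (by omega)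
    have hcard := hT' c hc hcr hp
    have hpos : 0 < S.card := Finset.card_pos.2 ⟨c, hc⟩
    exact (ih _ (by omega) (T'.branchTree hc hcr hp) f hf rfl).mono (by omega)

end RootedSpanningTree

/-- A shortest-path tree of a connected graph. -/
theorem SimpleGraph.Connected.nonempty_rootedSpanningTree [Fintype V] (hG : G.Connected) (r : V) :
    Nonempty (RootedSpanningTree G Finset.univ r) := by
  have h : ∀ v, ∃ w, v ≠ r → G.Adj v w ∧ G.dist r v = G.dist r w + 1 := by
    intro v
    obtain ⟨p, hp⟩ := hG.exists_walk_length_eq_dist v r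
    cases p with
    | nil => exact ⟨r, fun h => (h rfl).elim⟩
    | @cons _ w _ hadj q =>
      refine ⟨w, fun _ => ⟨hadj, ?_⟩⟩
      have h1 := SimpleGraph.dist_le q
      have h2 := hG.dist_triangle (u := v) (v := w) (w := r)
      rw [SimpleGraph.dist_eq_one_iff_adj.2 hadj] at h2
      rw [SimpleGraph.Walk.length_cons] at hp
      rw [SimpleGraph.dist_comm (v := v), SimpleGraph.dist_comm (v := w)]
      omega
  choose par hpar using h
  exact ⟨⟨par, G.dist r, Finset.mem_univ _, SimpleGraph.dist_self, fun _ _ => Finset.mem_univ _,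
    fun _ h => (hpar _ h).1, fun _ h => (hpar _ h).2⟩⟩

theorem SimpleGraph.Connected.routableIn [Fintype V] (hG : G.Connected) (f : Perm V) :
    RoutableIn G f (3 * Fintype.card V) := by
  obtain ⟨r⟩ := hG.nonempty
  obtain ⟨T⟩ := hG.nonempty_rootedSpanningTree r
  exact (T.routableOn f fun v hv => (hv (Finset.mem_univ v)).elim).routableIn

end

/-- Any permutation on a connected graph (e.g. via a spanning tree) can be routed
in at most `3 n` matching steps; in particular `rt(G, π) = O(n)`. -/
theorem routingTime_le_three_mul_card
    {V : Type*} [Fintype V] [DecidableEq V] (G : SimpleGraph V) (hG : G.Connected)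
    (π : Equiv.Perm V) :
    routingTime G π ≤ 3 * Fintype.card V :=
  Nat.sInf_le (hG.routableIn π)
end

section
/- For any connected graph G and any sorted ordering π of its vertices, st(G, π) ≤ st(G) + O(n): fixing the target sorted order costs at most an additive O(n) over the optimal sorting network depth. -/
/-- A stage of a sorting network on vertex set `V`: `partner` is an involution whose
non-fixed pairs form the matched edges; a matched edge either always swaps the two
pebbles (`swapAlways`) or is a directed comparator, directed towards the endpoint
marked by `lo`, which receives the smaller pebble. -/
structure SortStep (V : Type*) where
  partner : V → V
  swapAlways : V → Bool
  lo : V → Bool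

/-- Well-formedness of a stage with respect to the graph `G`: `partner` is an
involutive matching of `G`, the `swapAlways` flag is consistent on a matched edge, and
every directed comparator has exactly one endpoint marked as lower. -/
def SortStep.WF {V : Type*} (G : SimpleGraph V) (s : SortStep V) : Prop :=
  (∀ v, s.partner (s.partner v) = v) ∧
  (∀ v, s.partner v ≠ v → G.Adj v (s.partner v)) ∧
  (∀ v, s.partner v ≠ v → s.swapAlways v = s.swapAlways (s.partner v)) ∧
  (∀ v, s.partner v ≠ v → s.swapAlways v = false → s.lo v = !s.lo (s.partner v))

/-- Apply one stage to an arrangement `x` of values on the vertices. -/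
def SortStep.apply {V : Type*} [DecidableEq V] {α : Type*} [LinearOrder α]
    (s : SortStep V) (x : V → α) : V → α := fun v =>
  if s.partner v = v then x v
  else if s.swapAlways v then x (s.partner v)
  else if s.lo v then min (x v) (x (s.partner v))
  else max (x v) (x (s.partner v))

/-- Apply a sequence of stages to an initial arrangement. -/
def applyNetwork {V : Type*} [DecidableEq V] {α : Type*} [LinearOrder α]
    (M : List (SortStep V)) (x : V → α) : V → α :=
  M.foldl (fun y s => s.apply y) x

/-- `M` is a sorting network on `G` with sorted ordering given by the injective
ranking `rk`: for every initial arrangement, the final arrangement is sorted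
according to `rk`. -/
def IsSortingNetwork {V : Type*} [DecidableEq V] (G : SimpleGraph V)
    (M : List (SortStep V)) (rk : V → ℕ) : Prop :=
  Function.Injective rk ∧ (∀ s ∈ M, s.WF G) ∧
    ∀ x : V → ℕ, ∀ u v, rk u ≤ rk v → applyNetwork M x u ≤ applyNetwork M x v

/-- `st(G, π)`: the minimum depth of a sorting network on `G` with the fixed
sorted ordering `rk`. -/
noncomputable def sortingNumberOrd {V : Type*} [DecidableEq V] (G : SimpleGraph V)
    (rk : V → ℕ) : ℕ :=
  sInf {k | ∃ M : List (SortStep V), M.length = k ∧ IsSortingNetwork G M rk}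

/-- The sorting number `st(G)`: the minimum depth of a sorting network on `G`,
over all sorted orderings. -/
noncomputable def sortingNumber {V : Type*} [DecidableEq V] (G : SimpleGraph V) : ℕ :=
  sInf {k | ∃ (M : List (SortStep V)) (rk : V → ℕ), M.length = k ∧ IsSortingNetwork G M rk}

open Equiv

namespace PermRouting

variable {V : Type*}

/-- A permutation exchanging the endpoints of the edges of a matching of `G`. -/
def IsMatchingPerm (G : SimpleGraph V) (f : Perm V) : Prop :=
  (∀ v, f (f v) = v) ∧ ∀ v, f v ≠ v → G.Adj v (f v)

/-- `σ` is a product of `k` matching permutations of `G`. -/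
def Routable (G : SimpleGraph V) : ℕ → Perm V → Prop
  | 0, σ => σ = 1
  | k + 1, σ => ∃ f τ, IsMatchingPerm G f ∧ Routable G k τ ∧ σ = f * τ

theorem IsMatchingPerm.one (G : SimpleGraph V) : IsMatchingPerm G 1 :=
  ⟨fun _ => rfl, fun _ h => absurd rfl h⟩

theorem IsMatchingPerm.mul {G : SimpleGraph V} {f g : Perm V} (hf : IsMatchingPerm G f)
    (hg : IsMatchingPerm G g) (hd : f.Disjoint g) : IsMatchingPerm G (f * g) := by
  have key : ∀ v, (f * g) v = f v ∧ g v = v ∨ (f * g) v = g v ∧ f v = v := by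
    intro v
    rcases hd v with h | h
    · right
      refine ⟨?_, h⟩
      rw [hd.commute.eq, Perm.mul_apply, h]
    · left
      exact ⟨by rw [Perm.mul_apply, h], h⟩
  refine ⟨fun v => ?_, fun v hv => ?_⟩
  · have hc : (f * g) * (f * g) = 1 := by
      have h1 : f * f = 1 := Perm.ext hf.1
      have h2 : g * g = 1 := Perm.ext hg.1
      calc (f * g) * (f * g) = f * (g * f) * g := by group
        _ = f * (f * g) * g := by rw [hd.commute.eq]
        _ = (f * f) * (g * g) := by group
        _ = 1 := by rw [h1, h2, one_mul]
    exact Perm.ext_iff.1 hc v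
  · rcases key v with ⟨h, -⟩ | ⟨h, -⟩
    · rw [h] at hv ⊢
      exact hf.2 v hv
    · rw [h] at hv ⊢
      exact hg.2 v hv

theorem Routable.one (G : SimpleGraph V) : ∀ k, Routable G k 1
  | 0 => rfl
  | k + 1 => ⟨1, 1, .one G, Routable.one G k, (one_mul 1).symm⟩

theorem Routable.mul {G : SimpleGraph V} {k l : ℕ} {σ τ : Perm V} (hσ : Routable G k σ)
    (hτ : Routable G l τ) : Routable G (k + l) (σ * τ) := by
  induction k generalizing σ with
  | zero =>
    obtain rfl : σ = 1 := hσ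
    simpa using hτ
  | succ k ih =>
    obtain ⟨f, ρ, hf, hρ, rfl⟩ := hσ
    rw [Nat.succ_add]
    exact ⟨f, ρ * τ, hf, ih hρ, mul_assoc _ _ _⟩

theorem Routable.mono {G : SimpleGraph V} {k l : ℕ} {σ : Perm V} (hσ : Routable G k σ)
    (h : k ≤ l) : Routable G l σ := by
  obtain ⟨m, rfl⟩ := Nat.exists_eq_add_of_le h
  simpa using hσ.mul (Routable.one G m)

section Fibers

variable {ι : Type*} (b : V → ι)

/-- The permutation of `V` acting on each fiber of `b` by a prescribed permutation. -/
def fiberHom : (∀ c, Perm {v // b v = c}) →* Perm V :=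
  (Equiv.permCongrHom (Equiv.sigmaFiberEquiv b)).toMonoidHom.comp
    (Perm.sigmaCongrRightHom fun c => {v // b v = c})

theorem fiberHom_apply (f : ∀ c, Perm {v // b v = c}) (v : V) :
    fiberHom b f v = f (b v) ⟨v, rfl⟩ := rfl

theorem IsMatchingPerm.fiberHom {G : SimpleGraph V} {f : ∀ c, Perm {v // b v = c}}
    (hf : ∀ c, IsMatchingPerm (G.induce {v | b v = c}) (f c)) :
    IsMatchingPerm G (fiberHom b f) := by
  constructor
  · intro v
    rw [← Perm.mul_apply, ← map_mul]
    have : f * f = 1 := funext fun c => Perm.ext (hf c).1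
    rw [this, map_one, Perm.one_apply]
  · intro v hv
    rw [fiberHom_apply] at hv ⊢
    exact (hf (b v)).2 ⟨v, rfl⟩ fun h => hv (congrArg Subtype.val h)

theorem Routable.fiberHom {G : SimpleGraph V} {k : ℕ} {σ : ∀ c, Perm {v // b v = c}}
    (hσ : ∀ c, Routable (G.induce {v | b v = c}) k (σ c)) :
    Routable G k (fiberHom b σ) := by
  induction k generalizing σ with
  | zero =>
    obtain rfl : σ = 1 := funext hσ
    exact map_one _
  | succ k ih =>
    choose f τ hf hτ h using hσ
    refine ⟨_, _, IsMatchingPerm.fiberHom b hf, ih hτ, ?_⟩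
    rw [← map_mul]
    exact congrArg _ (funext h)

theorem exists_fiberHom_eq {σ : Perm V} (hσ : ∀ v, b (σ v) = b v) :
    ∃ τ : ∀ c, Perm {v // b v = c}, fiberHom b τ = σ :=
  ⟨fun c => σ.subtypePerm fun v => by rw [hσ], Perm.ext fun _ => rfl⟩

end Fibers

section Pipeline

variable (G : SimpleGraph V) (level : V → ℕ)

/-- A top-down sweep: a product of `k` matching permutations, the `i`-th of which only moves
vertices at levels `a + i` and `a + i + 1`. -/
def Sweep : ℕ → ℕ → Perm V → Prop
  | _, 0, σ => σ = 1
  | a, k + 1, σ => ∃ f τ, IsMatchingPerm G f ∧ (∀ v, f v ≠ v → level v = a ∨ level v = a + 1) ∧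
      Sweep (a + 1) k τ ∧ σ = f * τ

/-- A product of `k` matching permutations, the `i`-th of which only moves vertices at levels
below `a + i`. -/
def Schedule : ℕ → ℕ → Perm V → Prop
  | _, 0, σ => σ = 1
  | a, k + 1, σ => ∃ f τ, IsMatchingPerm G f ∧ (∀ v, f v ≠ v → level v < a) ∧
      Schedule (a + 1) k τ ∧ σ = f * τ

/-- A product of `m` sweeps of length `k` starting at level zero. -/
def Sweeps (k : ℕ) : ℕ → Perm V → Prop
  | 0, σ => σ = 1
  | m + 1, σ => ∃ f τ, Sweep G level 0 k f ∧ Sweeps k m τ ∧ σ = f * τ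

variable {G level}

theorem Sweep.one (a k : ℕ) : Sweep G level a k 1 := by
  induction k generalizing a with
  | zero => rfl
  | succ k ih => exact ⟨1, 1, .one G, fun _ h => absurd rfl h, ih _, (one_mul 1).symm⟩

theorem Sweep.mono {a k l : ℕ} {σ : Perm V} (h : Sweep G level a k σ) (hkl : k ≤ l) :
    Sweep G level a l σ := by
  induction k generalizing a l σ with
  | zero =>
    obtain rfl : σ = 1 := h
    exact Sweep.one a l
  | succ k ih =>
    obtain ⟨f, τ, hf, hl, hτ, rfl⟩ := h
    obtain ⟨l, rfl⟩ : ∃ m, l = m + 1 := ⟨l - 1, by omega⟩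
    exact ⟨f, τ, hf, hl, ih hτ (by omega), rfl⟩

theorem Sweep.of_le {a b k : ℕ} {σ : Perm V} (h : Sweep G level (a + b) k σ) :
    Sweep G level a (b + k) σ := by
  induction b generalizing a with
  | zero => simpa using h
  | succ b ih =>
    rw [Nat.succ_add]
    refine ⟨1, σ, .one G, fun _ h => absurd rfl h, ih ?_, (one_mul σ).symm⟩
    rwa [Nat.succ_add_eq_add_succ]

theorem Sweep.level_le {a k : ℕ} {σ : Perm V} (h : Sweep G level a k σ) {v : V}
    (hv : σ v ≠ v) : a ≤ level v := by
  induction k generalizing a σ with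
  | zero =>
    obtain rfl : σ = 1 := h
    exact absurd rfl hv
  | succ k ih =>
    obtain ⟨f, τ, hf, hl, hτ, rfl⟩ := h
    by_cases hvτ : τ v = v
    · rw [Perm.mul_apply, hvτ] at hv
      rcases hl v hv with h | h <;> omega
    · have := ih hτ hvτ
      omega

theorem Schedule.one (a k : ℕ) : Schedule G level a k 1 := by
  induction k generalizing a with
  | zero => rfl
  | succ k ih => exact ⟨1, 1, .one G, fun _ h => absurd rfl h, ih _, (one_mul 1).symm⟩

theorem Schedule.routable {a k : ℕ} {σ : Perm V} (h : Schedule G level a k σ) :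
    Routable G k σ := by
  induction k generalizing a σ with
  | zero => exact h
  | succ k ih =>
    obtain ⟨f, τ, hf, -, hτ, rfl⟩ := h
    exact ⟨f, τ, hf, ih hτ, rfl⟩

/-- A sweep two levels ahead of a schedule can be executed in parallel with it. -/
theorem Sweep.mul_schedule {a k : ℕ} {σ τ : Perm V} (hσ : Sweep G level a k σ)
    (hτ : Schedule G level a k τ) : Schedule G level (a + 2) k (σ * τ) := by
  induction k generalizing a σ τ with
  | zero =>
    obtain rfl : σ = 1 := hσ
    obtain rfl : τ = 1 := hτ
    exact one_mul 1
  | succ k ih =>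
    obtain ⟨f, σ, hf, hfl, hσ, rfl⟩ := hσ
    obtain ⟨g, τ, hg, hgl, hτ, rfl⟩ := hτ
    have hfg : f.Disjoint g := by
      intro v
      by_contra! h
      have h1 := hfl v h.1
      have h2 := hgl v h.2
      omega
    have hσg : σ.Disjoint g := by
      intro v
      by_contra! h
      have h1 := hσ.level_le h.1
      have h2 := hgl v h.2
      omega
    refine ⟨f * g, σ * τ, hf.mul hg hfg, fun v hv => ?_, ?_, ?_⟩
    · by_contra! h
      have h1 : f v = v := by
        by_contra h'
        have := hfl v h'
        omega
      have h2 : g v = v := by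
        by_contra h'
        have := hgl v h'
        omega
      exact hv (by rw [Perm.mul_apply, h2, h1])
    · exact ih hσ hτ
    · calc f * σ * (g * τ) = f * (σ * g) * τ := by group
        _ = f * (g * σ) * τ := by rw [hσg.commute.eq]
        _ = f * g * (σ * τ) := by group

/-- Successive sweeps can be pipelined, each starting two time steps after the previous one. -/
theorem Sweeps.schedule {k m : ℕ} {σ : Perm V} (h : Sweeps G level k m σ) :
    Schedule G level 2 (k + 2 * m) σ := by
  induction m generalizing σ with
  | zero =>
    obtain rfl : σ = 1 := h
    exact Schedule.one _ _
  | succ m ih =>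
    obtain ⟨f, τ, hf, hτ, rfl⟩ := h
    obtain ⟨f₀, f', h₀, hl₀, ⟨f₁, f₂, h₁, hl₁, hf₂, rfl⟩, rfl⟩ :=
      hf.mono (show k ≤ k + 2 * m + 1 + 1 by omega)
    refine ⟨f₀, f₁ * (f₂ * τ), h₀, fun v hv => ?_,
      ⟨f₁, f₂ * τ, h₁, fun v hv => ?_, hf₂.mul_schedule (ih hτ), rfl⟩, by group⟩
    · have := hl₀ v hv
      omega
    · have := hl₁ v hv
      omega

end Pipeline

/-- A spanning tree of `G` given by a parent function; `branch v` is the vertex at level one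
on the path from the root to `v`. -/
structure IsRooted (G : SimpleGraph V) (root : V) (level : V → ℕ) (parent branch : V → V) :
    Prop where
  level_root : level root = 0
  adj : ∀ v, v ≠ root → G.Adj (parent v) v
  level_parent : ∀ v, v ≠ root → level v = level (parent v) + 1
  branch_root : branch root = root
  branch_eq_self : ∀ v, level v = 1 → branch v = v
  branch_parent : ∀ v, 2 ≤ level v → branch (parent v) = branch v

/-- In the arrangement `x` of destinations, the pebble at `v` belongs to another branch. -/
def Misplaced (branch : V → V) (x : Perm V) (v : V) : Prop :=
  branch (x v) ≠ branch v

/-- Misplaced pebbles precede the others along each path starting at level `a`. -/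
def HeapFrom (level : V → ℕ) (parent branch : V → V) (a : ℕ) (x : Perm V) : Prop :=
  ∀ u, a + 1 ≤ level u → Misplaced branch x u → Misplaced branch x (parent u)

/-- The heap property from level `a`, except for a possible violation between levels `j` and
`j + 1`, where misplaced pebbles have misplaced grandparents. -/
def SiftInv (level : V → ℕ) (parent branch : V → V) (a j : ℕ) (x : Perm V) : Prop :=
  (∀ u, a + 1 ≤ level u → level u ≠ j + 1 →
    Misplaced branch x u → Misplaced branch x (parent u)) ∧
  (a + 1 ≤ j → ∀ u, level u = j + 1 →
    Misplaced branch x u → Misplaced branch x (parent (parent u)))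

namespace IsRooted

variable {G : SimpleGraph V} {root : V} {level : V → ℕ} {parent branch : V → V}

theorem ne_root (T : IsRooted G root level parent branch) {v : V} (h : 1 ≤ level v) :
    v ≠ root := by
  rintro rfl
  have := T.level_root
  omega

theorem level_pos (T : IsRooted G root level parent branch) {v : V} (h : v ≠ root) :
    1 ≤ level v := by
  rw [T.level_parent v h]
  omega

theorem level_branch (T : IsRooted G root level parent branch) {v : V} (h : v ≠ root) :
    level (branch v) = 1 := by
  induction hn : level v using Nat.strong_induction_on generalizing v with
  | _ n ih =>
    have h1 := T.level_pos h
    rcases Nat.lt_or_ge (level v) 2 with h2 | h2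
    · rw [T.branch_eq_self v (by omega)]
      omega
    · have h3 := T.level_parent v h
      rw [← T.branch_parent v h2]
      exact ih (level (parent v)) (by omega) (T.ne_root (by omega)) rfl

theorem branch_eq_root_iff (T : IsRooted G root level parent branch) {v : V} :
    branch v = root ↔ v = root := by
  constructor
  · intro h
    by_contra hv
    have := T.level_branch hv
    rw [h, T.level_root] at this
    omega
  · rintro rfl
    exact T.branch_root

/-- One layer of a sift: every well-placed pebble at level `j` is exchanged with a misplaced
child, if there is one. -/
theorem exists_layer (T : IsRooted G root level parent branch) {j : ℕ} (hj : 1 ≤ j)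
    (x : Perm V) :
    ∃ f : Perm V, IsMatchingPerm G f ∧ (∀ v, f v ≠ v → level v = j ∨ level v = j + 1) ∧
      (∀ v, branch (f v) = branch v) ∧
      (∀ v, level v = j → (Misplaced branch (x * f) v ↔
        Misplaced branch x v ∨ ∃ u, level u = j + 1 ∧ parent u = v ∧ Misplaced branch x u)) ∧
      (∀ u, level u = j + 1 → Misplaced branch (x * f) u → Misplaced branch x u) ∧
      (∀ v, level v ≠ j → level v ≠ j + 1 → (x * f) v = x v) := by
  classical
  let P : V → V → Prop := fun v u => level u = j + 1 ∧ parent u = v ∧ Misplaced branch x u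
  let A : V → Prop := fun v => level v = j ∧ ¬ Misplaced branch x v ∧ ∃ u, P v u
  have hch : ∀ v, ∃ u, (∃ u', P v u') → P v u := by
    intro v
    by_cases h : ∃ u', P v u'
    · exact ⟨h.choose, fun _ => h.choose_spec⟩
    · exact ⟨v, fun h' => absurd h' h⟩
  choose ch hch using hch
  have hA : ∀ v, A v → level (ch v) = j + 1 ∧ parent (ch v) = v ∧ Misplaced branch x (ch v) :=
    fun v hv => hch v hv.2.2
  let f : V → V := fun w =>
    if A w then ch w else if A (parent w) ∧ w = ch (parent w) then parent w else w
  have hf1 : ∀ w, A w → f w = ch w := fun w hw => if_pos hw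
  have hnA : ∀ w, level w = j + 1 → ¬ A w := fun w hw h => by
    have := h.1
    omega
  have hf2 : ∀ w, A w → f (ch w) = w := by
    intro w hw
    obtain ⟨h1, h2, -⟩ := hA w hw
    have : A (parent (ch w)) ∧ ch w = ch (parent (ch w)) := by rw [h2]; exact ⟨hw, rfl⟩
    simp only [f]
    rw [if_neg (hnA _ h1), if_pos this, h2]
  have hcases : ∀ w, A w ∨ (∃ v, A v ∧ w = ch v) ∨ (f w = w ∧ ¬ A w) := by
    intro w
    by_cases h : A w
    · exact Or.inl h
    · by_cases h' : A (parent w) ∧ w = ch (parent w)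
      · exact Or.inr (Or.inl ⟨_, h'⟩)
      · right; right
        refine ⟨?_, h⟩
        simp only [f]
        rw [if_neg h, if_neg h']
  have hinv : Function.Involutive f := by
    intro w
    rcases hcases w with h | ⟨v, h, rfl⟩ | ⟨h, -⟩
    · rw [hf1 w h, hf2 w h]
    · rw [hf2 v h, hf1 v h]
    · rw [h, h]
  have hadj : ∀ v, A v → G.Adj v (ch v) := by
    intro v hv
    obtain ⟨h1, h2, -⟩ := hA v hv
    have := T.adj (ch v) (T.ne_root (by omega))
    rwa [h2] at this
  have hbr : ∀ v, A v → branch (ch v) = branch v := by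
    intro v hv
    obtain ⟨h1, h2, -⟩ := hA v hv
    have := T.branch_parent (ch v) (by omega)
    rw [← this, h2]
  have hmis : ∀ w, (∀ v, branch (f v) = branch v) →
      (branch (x (f w)) ≠ branch w ↔ Misplaced branch x (f w)) := by
    intro w h
    unfold Misplaced
    rw [h]
  have hB : ∀ v, branch (f v) = branch v := by
    intro w
    rcases hcases w with h | ⟨v, h, rfl⟩ | ⟨h, -⟩
    · rw [hf1 w h, hbr w h]
    · rw [hf2 v h, hbr v h]
    · rw [h]
  refine ⟨hinv.toPerm, ⟨hinv, fun w hw => ?_⟩, fun w hw => ?_, hB, fun v hv => ?_,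
    fun u hu hm => ?_, fun v h1 h2 => ?_⟩
  · change f w ≠ w at hw
    change G.Adj w (f w)
    rcases hcases w with h | ⟨v, h, rfl⟩ | ⟨h, -⟩
    · rw [hf1 w h]
      exact hadj w h
    · rw [hf2 v h]
      exact (hadj v h).symm
    · exact absurd h hw
  · change f w ≠ w at hw
    rcases hcases w with h | ⟨v, h, rfl⟩ | ⟨h, -⟩
    · exact Or.inl h.1
    · exact Or.inr (hA v h).1
    · exact absurd h hw
  · refine (hmis v hB).trans ?_
    rcases hcases v with h | ⟨w, h, rfl⟩ | ⟨h, h'⟩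
    · rw [hf1 v h]
      exact ⟨fun _ => Or.inr h.2.2, fun _ => (hA v h).2.2⟩
    · have := (hA w h).1
      omega
    · rw [h]
      refine ⟨Or.inl, fun h'' => h''.elim id fun hu => ?_⟩
      by_contra hm
      exact h' ⟨hv, hm, hu⟩
  · replace hm := (hmis u hB).1 hm
    rcases hcases u with h | ⟨w, h, rfl⟩ | ⟨h, h'⟩
    · have := h.1
      omega
    · exact (hA w h).2.2
    · rwa [h] at hm
  · change x (f v) = x v
    rcases hcases v with h | ⟨w, h, rfl⟩ | ⟨h, h'⟩
    · exact absurd h.1 h1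
    · exact absurd (hA w h).1 h2
    · rw [h]

theorem siftInv_step (T : IsRooted G root level parent branch) {a j : ℕ} (ha : 1 ≤ a)
    (haj : a ≤ j) {x : Perm V} (hx : SiftInv level parent branch a j x) :
    ∃ f : Perm V, IsMatchingPerm G f ∧ (∀ v, f v ≠ v → level v = j ∨ level v = j + 1) ∧
      (∀ v, branch (f v) = branch v) ∧ SiftInv level parent branch a (j + 1) (x * f) := by
  obtain ⟨f, hf, hl, hb, h1, h2, h3⟩ := T.exists_layer (ha.trans haj) x
  refine ⟨f, hf, hl, hb, fun u hu huj hm => ?_, fun _ u hu hm => ?_⟩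
  · have hp := T.level_parent u (T.ne_root (by omega))
    have hsame : ∀ v, level v ≠ j → level v ≠ j + 1 →
        (Misplaced branch (x * f) v ↔ Misplaced branch x v) := by
      intro v h h'
      unfold Misplaced
      rw [h3 v h h']
    by_cases hj1 : level u = j + 1
    · exact (h1 _ (by omega)).2 (Or.inr ⟨u, hj1, rfl, h2 u hj1 hm⟩)
    by_cases hj0 : level u = j
    · rw [hsame _ (by omega) (by omega)]
      rcases (h1 u hj0).1 hm with h | ⟨w, hw, rfl, hm'⟩
      · exact hx.1 u hu (by omega) h
      · exact hx.2 (by omega) w hw hm'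
    · rw [hsame u hj0 hj1] at hm
      have := hx.1 u hu (by omega) hm
      by_cases hj2 : level (parent u) = j
      · omega
      · rwa [hsame _ hj2 (by omega)]
  · have hp := T.level_parent u (T.ne_root (by omega))
    have hp' := T.level_parent (parent u) (T.ne_root (by omega))
    have hmx : Misplaced branch x u := by
      unfold Misplaced at hm ⊢
      rwa [h3 u (by omega) (by omega)] at hm
    have := hx.1 u (by omega) (by omega) hmx
    exact (h1 _ (by omega)).2 (Or.inr ⟨parent u, by omega, rfl, this⟩)

theorem siftInv_sweep (T : IsRooted G root level parent branch) {a : ℕ} (ha : 1 ≤ a)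
    (k : ℕ) {j : ℕ} (haj : a ≤ j) {x : Perm V} (hx : SiftInv level parent branch a j x) :
    ∃ σ : Perm V, Sweep G level j k σ ∧ (∀ v, branch (σ v) = branch v) ∧
      SiftInv level parent branch a (j + k) (x * σ) := by
  induction k generalizing j x with
  | zero => exact ⟨1, rfl, fun _ => rfl, by simpa using hx⟩
  | succ k ih =>
    obtain ⟨f, hf, hl, hb, hi⟩ := T.siftInv_step ha haj hx
    obtain ⟨τ, hτ, hb', hnext⟩ := ih (by omega) hi
    refine ⟨f * τ, ⟨f, τ, hf, hl, hτ, rfl⟩, fun v => ?_, ?_⟩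
    · rw [Perm.mul_apply, hb, hb']
    · rw [← mul_assoc, ← Nat.succ_add_eq_add_succ]
      exact hnext

/-- One sweep extends the heap property by one level. -/
theorem exists_sift (T : IsRooted G root level parent branch) {a k : ℕ} (ha : 1 ≤ a)
    (hk : ∀ v, level v ≤ a + k) {x : Perm V} (hx : HeapFrom level parent branch (a + 1) x) :
    ∃ σ : Perm V, Sweep G level a k σ ∧ (∀ v, branch (σ v) = branch v) ∧
      HeapFrom level parent branch a (x * σ) := by
  obtain ⟨σ, hσ, hb, hi⟩ := T.siftInv_sweep ha k le_rfl
    (x := x) ⟨fun u h h' => hx u (by omega), fun h => by omega⟩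
  refine ⟨σ, hσ, hb, fun u hu => hi.1 u hu ?_⟩
  have := hk u
  omega

theorem misplaced_branch (T : IsRooted G root level parent branch) {x : Perm V}
    (hx : HeapFrom level parent branch 1 x) {v : V} (hv : v ≠ root)
    (hm : Misplaced branch x v) : Misplaced branch x (branch v) := by
  induction hn : level v using Nat.strong_induction_on generalizing v with
  | _ n ih =>
    have h1 := T.level_pos hv
    rcases Nat.lt_or_ge (level v) 2 with h2 | h2
    · rwa [T.branch_eq_self v (by omega)]
    · have h3 := T.level_parent v hv
      rw [← T.branch_parent v h2]
      exact ih (level (parent v)) (by omega) (T.ne_root (by omega)) (hx v h2 hm) rfl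

end IsRooted

theorem Sweeps.one {G : SimpleGraph V} {level : V → ℕ} (k m : ℕ) : Sweeps G level k m 1 := by
  induction m with
  | zero => rfl
  | succ m ih => exact ⟨1, 1, Sweep.one _ _, ih, (one_mul 1).symm⟩

open Classical in
/-- The number of misplaced pebbles away from the root. -/
noncomputable def strays [Fintype V] (root : V) (branch : V → V) (x : Perm V) : ℕ :=
  (Finset.univ.filter fun v => v ≠ root ∧ Misplaced branch x v).card

open Classical in
/-- A potential bounding the number of exchanges through the root. -/
noncomputable def potential [Fintype V] (root : V) (branch : V → V) (x : Perm V) : ℕ :=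
  2 * strays root branch x + if x root = root then 1 else 0

namespace IsRooted

variable {G : SimpleGraph V} {root : V} {level : V → ℕ} {parent branch : V → V}

theorem apply_root (T : IsRooted G root level parent branch) {σ : Perm V}
    (hσ : ∀ v, branch (σ v) = branch v) : σ root = root := by
  rw [← T.branch_eq_root_iff, hσ, T.branch_root]

theorem branch_branch (T : IsRooted G root level parent branch) {v : V} :
    branch (branch v) = branch v := by
  by_cases h : v = root
  · rw [h, T.branch_root, T.branch_root]
  · exact T.branch_eq_self _ (T.level_branch h)

variable [Fintype V]

theorem potential_mul (T : IsRooted G root level parent branch) (x : Perm V) {σ : Perm V}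
    (hσ : ∀ v, branch (σ v) = branch v) :
    potential root branch (x * σ) = potential root branch x := by
  classical
  have hr := T.apply_root hσ
  have hs : strays root branch (x * σ) = strays root branch x := by
    refine Finset.card_bij (fun v _ => σ v) ?_ (fun _ _ _ _ h => σ.injective h) ?_
    · intro v hv
      rw [Finset.mem_filter_univ] at hv ⊢
      refine ⟨fun h => hv.1 (σ.injective (h.trans hr.symm)), ?_⟩
      rw [Misplaced, hσ]
      exact hv.2
    · intro v hv
      rw [Finset.mem_filter_univ] at hv
      refine ⟨σ.symm v, ?_, σ.apply_symm_apply v⟩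
      rw [Finset.mem_filter_univ]
      refine ⟨fun h => hv.1 ?_, ?_⟩
      · rw [← σ.apply_symm_apply v, h, hr]
      · rw [Misplaced, Perm.mul_apply, σ.apply_symm_apply, ← hσ (σ.symm v), σ.apply_symm_apply]
        exact hv.2
  rw [potential, potential, hs, Perm.mul_apply, hr]

theorem exists_misplaced (T : IsRooted G root level parent branch) {x : Perm V}
    (hx : x root ≠ root) : ∃ v, branch v = branch (x root) ∧ Misplaced branch x v := by
  classical
  by_contra! h
  simp only [Misplaced, not_not] at h
  let S := Finset.univ.filter fun v => branch v = branch (x root)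
  have hsub : S.image x ⊆ S := by
    intro w hw
    obtain ⟨v, hv, rfl⟩ := Finset.mem_image.1 hw
    have hv' : branch v = branch (x root) := (Finset.mem_filter.1 hv).2
    exact Finset.mem_filter.2 ⟨Finset.mem_univ _, (h v hv').trans hv'⟩
  have heq := Finset.eq_of_subset_of_card_le hsub
    (Finset.card_image_of_injective S x.injective).ge
  have hmem : x root ∈ S.image x := by
    rw [heq]
    exact Finset.mem_filter.2 ⟨Finset.mem_univ _, rfl⟩
  obtain ⟨v, hv, hvx⟩ := Finset.mem_image.1 hmem
  obtain rfl := x.injective hvx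
  have h1 : branch v = branch (x v) := (Finset.mem_filter.1 hv).2
  rw [T.branch_root] at h1
  exact hx (T.branch_eq_root_iff.1 h1.symm)

open Classical in
theorem potential_swap_lt (T : IsRooted G root level parent branch)
    {x : Perm V} (hx : HeapFrom level parent branch 1 x)
    (hm : ∃ v, v ≠ root ∧ Misplaced branch x v) :
    ∃ c, level c = 1 ∧
      potential root branch (x * swap root c) < potential root branch x := by
  have hother : ∀ c v, v ≠ root → v ≠ c → (x * swap root c) v = x v := fun c v h h' => by
    rw [Perm.mul_apply, swap_apply_of_ne_of_ne h h']
  by_cases hr : x root = root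
  · obtain ⟨v, hv, hm⟩ := hm
    have hl := T.level_branch hv
    have hc := T.ne_root hl.ge
    refine ⟨branch v, hl, ?_⟩
    have hle : strays root branch (x * swap root (branch v)) ≤ strays root branch x := by
      refine Finset.card_le_card fun w hw => ?_
      rw [Finset.mem_filter_univ] at hw ⊢
      refine ⟨hw.1, ?_⟩
      by_cases hwc : w = branch v
      · rw [hwc]
        exact T.misplaced_branch hx hv hm
      · have := hw.2
        rwa [Misplaced, hother _ w hw.1 hwc] at this
    have hr' : (x * swap root (branch v)) root ≠ root := by
      rw [Perm.mul_apply, swap_apply_left]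
      exact fun h => hc (x.injective (h.trans hr.symm))
    rw [potential, potential, if_pos hr, if_neg hr']
    omega
  · obtain ⟨v, hv, hm⟩ := T.exists_misplaced hr
    have hv0 : v ≠ root := by
      rintro rfl
      rw [T.branch_root] at hv
      exact hr (T.branch_eq_root_iff.1 hv.symm)
    have hl := T.level_branch hv0
    have hc := T.ne_root hl.ge
    refine ⟨branch v, hl, ?_⟩
    have hgood : ¬ Misplaced branch (x * swap root (branch v)) (branch v) := by
      rw [Misplaced, Perm.mul_apply, swap_apply_right, ← hv, T.branch_branch]
      exact fun h => h rfl
    have hlt : strays root branch (x * swap root (branch v)) < strays root branch x := by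
      refine Finset.card_lt_card ((Finset.ssubset_iff_of_subset fun w hw => ?_).2
        ⟨branch v, ?_, ?_⟩)
      · rw [Finset.mem_filter_univ] at hw ⊢
        refine ⟨hw.1, ?_⟩
        have hwc : w ≠ branch v := by
          rintro rfl
          exact hgood hw.2
        have := hw.2
        rwa [Misplaced, hother _ w hw.1 hwc] at this
      · exact Finset.mem_filter.2 ⟨Finset.mem_univ _, hc, T.misplaced_branch hx hv0 hm⟩
      · exact fun h => hgood (Finset.mem_filter.1 h).2.2
    rw [potential, potential, if_neg hr]
    split_ifs <;> omega

/-- A sweep exchanging a pebble through the root decreases the potential. -/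
theorem exists_exchange (T : IsRooted G root level parent branch) {k : ℕ}
    (hk : ∀ v, level v ≤ 1 + k) {x : Perm V} (hx : HeapFrom level parent branch 1 x)
    (hm : ∃ v, v ≠ root ∧ Misplaced branch x v) :
    ∃ σ : Perm V, Sweep G level 0 (k + 1) σ ∧ HeapFrom level parent branch 1 (x * σ) ∧
      potential root branch (x * σ) < potential root branch x := by
  classical
  obtain ⟨c, hc, hlt⟩ := T.potential_swap_lt hx hm
  have hcr := T.ne_root hc.ge
  have hpc : parent c = root := by
    by_contra h
    have h1 := T.level_pos h
    have h2 := T.level_parent c hcr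
    omega
  have hadj : G.Adj root c := by
    have := T.adj c hcr
    rwa [hpc] at this
  have hsame : ∀ v, 2 ≤ level v →
      (Misplaced branch (x * swap root c) v ↔ Misplaced branch x v) := by
    intro v hv
    have h : v ≠ c := by
      rintro rfl
      omega
    rw [Misplaced, Misplaced, Perm.mul_apply,
      swap_apply_of_ne_of_ne (T.ne_root (by omega)) h]
  have hx2 : HeapFrom level parent branch 2 (x * swap root c) := by
    intro u hu hm
    have := T.level_parent u (T.ne_root (by omega))
    rw [hsame u (by omega)] at hm
    rw [hsame _ (by omega)]
    exact hx u (by omega) hm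
  obtain ⟨τ, hτ, hb, hh⟩ := T.exists_sift le_rfl hk hx2
  refine ⟨swap root c * τ, ⟨swap root c, τ, ⟨fun v => ?_, fun v hv => ?_⟩, fun v hv => ?_,
    hτ, rfl⟩, ?_, ?_⟩
  · exact swap_apply_self _ _ v
  · rcases eq_or_ne v root with rfl | h1
    · rwa [swap_apply_left]
    rcases eq_or_ne v c with rfl | h2
    · rw [swap_apply_right]
      exact hadj.symm
    · exact absurd (swap_apply_of_ne_of_ne h1 h2) hv
  · rcases eq_or_ne v root with rfl | h1
    · exact Or.inl T.level_root
    rcases eq_or_ne v c with rfl | h2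
    · exact Or.inr hc
    · exact absurd (swap_apply_of_ne_of_ne h1 h2) hv
  · rwa [← mul_assoc]
  · rwa [← mul_assoc, T.potential_mul _ hb]

theorem exists_sweeps_of_heap (T : IsRooted G root level parent branch) {k : ℕ}
    (hk : ∀ v, level v ≤ 1 + k) (m : ℕ) {x : Perm V}
    (hx : HeapFrom level parent branch 1 x) (hp : potential root branch x ≤ m) :
    ∃ σ : Perm V, Sweeps G level (k + 1) m σ ∧ ∀ v, branch ((x * σ) v) = branch v := by
  induction m generalizing x with
  | zero =>
    refine ⟨1, rfl, ?_⟩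
    by_contra! h
    obtain ⟨v, hv⟩ := h
    have hm : ∃ v, v ≠ root ∧ Misplaced branch x v := by
      by_cases hvr : v = root
      · subst hvr
        have hxr : x v ≠ v := fun h => hv (congrArg branch h)
        obtain ⟨w, hw, hm⟩ := T.exists_misplaced hxr
        refine ⟨w, ?_, hm⟩
        rintro rfl
        exact hm hw.symm
      · exact ⟨v, hvr, hv⟩
    obtain ⟨σ, -, -, hlt⟩ := T.exists_exchange hk hx hm
    omega
  | succ m ih =>
    by_cases hm : ∃ v, v ≠ root ∧ Misplaced branch x v
    · obtain ⟨σ, hσ, hh, hlt⟩ := T.exists_exchange hk hx hm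
      obtain ⟨τ, hτ, hb⟩ := ih hh (by omega)
      exact ⟨σ * τ, ⟨σ, τ, hσ, hτ, rfl⟩, by rwa [← mul_assoc]⟩
    · refine ⟨1, Sweeps.one _ _, fun v => ?_⟩
      push Not at hm
      simp only [Misplaced, not_not] at hm
      rw [mul_one]
      by_cases hvr : v = root
      · subst hvr
        by_contra h
        have hxr : x v ≠ v := fun h' => h (congrArg branch h')
        obtain ⟨w, hw, hm'⟩ := T.exists_misplaced hxr
        refine hm' (hm w ?_)
        rintro rfl
        exact h hw.symm
      · exact hm v hvr

theorem exists_sweeps (T : IsRooted G root level parent branch) {k : ℕ}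
    (hk : ∀ v, level v ≤ 1 + k) {m : ℕ} (hm : ∀ x, potential root branch x ≤ m) {a : ℕ}
    (ha : a ≤ k) {x : Perm V} (hx : HeapFrom level parent branch (a + 1) x) :
    ∃ σ : Perm V, Sweeps G level (k + 1) (m + a) σ ∧ ∀ v, branch ((x * σ) v) = branch v := by
  induction a generalizing x with
  | zero => exact T.exists_sweeps_of_heap hk m hx (hm x)
  | succ a ih =>
    obtain ⟨σ, hσ, -, hh⟩ := T.exists_sift (a := a + 1) (k := k - a) (by omega)
      (fun v => (hk v).trans (by omega)) hx
    obtain ⟨τ, hτ, hb⟩ := ih (by omega) hh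
    have hσ' : Sweep G level 0 (a + 1 + (k - a)) σ := Sweep.of_le (by rwa [Nat.zero_add])
    exact ⟨σ * τ, ⟨σ, τ, hσ'.mono (by omega), hτ, rfl⟩, by rwa [← mul_assoc]⟩

theorem potential_le (x : Perm V) :
    potential root branch x ≤ 2 * Fintype.card V + 1 := by
  classical
  have : strays root branch x ≤ Fintype.card V := Finset.card_le_univ _
  unfold potential
  split_ifs <;> omega

/-- In linearly many steps every pebble can be moved to the branch of its destination. -/
theorem exists_routable (T : IsRooted G root level parent branch)
    (hl : ∀ v, level v < Fintype.card V) (x : Perm V) :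
    ∃ σ : Perm V, Routable G (9 * Fintype.card V) σ ∧ ∀ v, branch ((x * σ) v) = branch v := by
  have hn := hl root
  obtain ⟨k, hk⟩ : ∃ k, Fintype.card V = k + 1 := ⟨Fintype.card V - 1, by omega⟩
  have hk' : ∀ v, level v ≤ 1 + k := fun v => by
    have := hl v
    omega
  obtain ⟨σ, hσ, hb⟩ := T.exists_sweeps (x := x) hk' potential_le (a := k) le_rfl
    (fun u hu => by
      have := hk' u
      omega)
  exact ⟨σ, hσ.schedule.routable.mono (by omega), hb⟩

end IsRooted

/-- A connected graph has a rooted spanning tree all of whose branches contain at most half of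
the vertices. -/
theorem exists_isRooted [Fintype V] {G : SimpleGraph V} (hG : G.Connected) :
    ∃ root level parent branch, IsRooted G root level parent branch ∧
      (∀ v, level v < Fintype.card V) ∧
      ∀ c, c ≠ root → 2 * Nat.card {v // branch v = c} ≤ Fintype.card V := by
  classical
  obtain ⟨root, -, hroot⟩ := Finset.exists_min_image Finset.univ (fun z => ∑ v, G.dist z v)
    ⟨hG.nonempty.some, Finset.mem_univ _⟩
  have hpar : ∀ v, ∃ u, v ≠ root → G.Adj u v ∧ G.dist root v = G.dist root u + 1 := by
    intro v
    by_cases hv : v = root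
    · exact ⟨v, fun h => absurd hv h⟩
    · obtain ⟨p, hp⟩ := hG.exists_walk_length_eq_dist v root
      cases p with
      | nil => exact absurd rfl hv
      | @cons _ u _ h p =>
        refine ⟨u, fun _ => ⟨h.symm, ?_⟩⟩
        have h1 := SimpleGraph.dist_le p
        have h2 : G.dist v root ≤ G.dist v u + G.dist u root := hG.dist_triangle
        rw [SimpleGraph.dist_eq_one_iff_adj.2 h] at h2
        rw [SimpleGraph.Walk.length_cons] at hp
        rw [G.dist_comm (u := root), G.dist_comm (u := root)]
        omega
  choose parent hparent using hpar
  let branch : V → V := fun v => parent^[G.dist root v - 1] v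
  have T : IsRooted G root (G.dist root) parent branch := by
    refine ⟨SimpleGraph.dist_self, fun v hv => (hparent v hv).1, fun v hv => (hparent v hv).2,
      ?_, fun v hv => ?_, fun v hv => ?_⟩
    · simp [branch]
    · simp [branch, hv]
    · have hv0 : v ≠ root := by
        rintro rfl
        simp at hv
      have h := (hparent v hv0).2
      simp only [branch]
      rw [← Function.iterate_succ_apply]
      congr 1
      omega
  refine ⟨root, G.dist root, parent, branch, T, fun v => ?_, fun c hc => ?_⟩
  · obtain ⟨p, hp, hlen⟩ := hG.exists_path_of_dist root v
    rw [← hlen]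
    exact hp.length_lt
  · have hdist : ∀ v, v ≠ root → G.dist (branch v) v + 1 ≤ G.dist root v := by
      intro v hv
      induction hn : G.dist root v using Nat.strong_induction_on generalizing v with
      | _ n ih =>
        have h1 := T.level_pos hv
        have h3 := (hparent v hv).2
        rcases Nat.lt_or_ge (G.dist root v) 2 with h2 | h2
        · rw [T.branch_eq_self v (by omega), SimpleGraph.dist_self]
          omega
        · rw [← T.branch_parent v h2]
          have h4 := ih _ (by omega) (parent v) (T.ne_root (by omega)) rfl
          have h5 : G.dist (branch (parent v)) v ≤
              G.dist (branch (parent v)) (parent v) + G.dist (parent v) v := hG.dist_triangle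
          rw [SimpleGraph.dist_eq_one_iff_adj.2 (hparent v hv).1] at h5
          omega
    rcases isEmpty_or_nonempty {v // branch v = c} with he | ⟨⟨w, rfl⟩⟩
    · simp
    have hw : w ≠ root := by
      rintro rfl
      exact hc T.branch_root
    have hl := T.level_branch hw
    have hle : ∀ v, G.dist (branch w) v + (if branch v = branch w then 2 else 0) ≤
        G.dist root v + 1 := by
      intro v
      split_ifs with h
      · have hv : v ≠ root := by
          rintro rfl
          rw [T.branch_root] at h
          exact hc h.symm
        have := hdist v hv
        rw [h] at this
        omega
      · have : G.dist (branch w) v ≤ G.dist (branch w) root + G.dist root v := hG.dist_triangle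
        rw [G.dist_comm (u := branch w) (v := root)] at this
        omega
    have hsum := Finset.sum_le_sum fun v (_ : v ∈ Finset.univ) => hle v
    rw [Finset.sum_add_distrib, Finset.sum_add_distrib, ← Finset.sum_filter] at hsum
    have hmin := hroot (branch w) (Finset.mem_univ _)
    rw [Nat.card_eq_fintype_card, Fintype.card_subtype]
    simp only [Finset.sum_const, smul_eq_mul, Finset.card_univ] at hsum
    omega

theorem IsRooted.connected_induce {G : SimpleGraph V} {root : V} {level : V → ℕ}
    {parent branch : V → V} (T : IsRooted G root level parent branch) {c : V} (hc : c ≠ root)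
    (hne : Nonempty {v // branch v = c}) : (G.induce {v | branch v = c}).Connected := by
  obtain ⟨w, rfl⟩ := hne
  have hw : w ≠ root := by
    rintro rfl
    exact hc T.branch_root
  have key : ∀ n v (hv : branch v = branch w), level v = n →
      (G.induce {v | branch v = branch w}).Reachable ⟨branch w, T.branch_branch⟩ ⟨v, hv⟩ := by
    intro n
    induction n with
    | zero =>
      intro v hv hn
      have : v = root := by
        by_contra h
        have := T.level_pos h
        omega
      rw [this, T.branch_root] at hv
      exact absurd hv.symm hc
    | succ n ih =>
      intro v hv hn
      have hv0 := T.ne_root (v := v) (by omega)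
      rcases Nat.lt_or_ge (level v) 2 with h2 | h2
      · have h := T.branch_eq_self v (by omega)
        have h' : v = branch w := h.symm.trans hv
        subst h'
        exact SimpleGraph.Reachable.refl _
      · have h3 := T.level_parent v hv0
        refine (ih (parent v) ((T.branch_parent v h2).trans hv) (by omega)).trans ?_
        exact SimpleGraph.Adj.reachable (SimpleGraph.induce_adj.2 (T.adj v hv0))
  exact SimpleGraph.connected_iff_exists_forall_reachable _ |>.2 ⟨_, fun v => key _ v.1 v.2 rfl⟩

/-- Every permutation can be routed on a connected graph in linearly many matching steps. -/
theorem routable_of_connected {V : Type*} [Fintype V] {G : SimpleGraph V} (hG : G.Connected)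
    (σ : Perm V) : Routable G (18 * Fintype.card V) σ := by
  classical
  induction hn : Fintype.card V using Nat.strong_induction_on generalizing V with
  | _ n ih =>
    subst hn
    obtain ⟨root, level, parent, branch, T, hl, hcard⟩ := exists_isRooted hG
    obtain ⟨ρ, hρ, hb⟩ := T.exists_routable hl σ⁻¹
    obtain ⟨τ, hτ⟩ := exists_fiberHom_eq branch hb
    have hbranch : ∀ c, Routable (G.induce {v | branch v = c})
        (9 * Fintype.card V) (τ⁻¹ c) := by
      intro c
      rcases isEmpty_or_nonempty {v // branch v = c} with he | hne
      · rw [Subsingleton.elim (τ⁻¹ c) 1]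
        exact Routable.one _ _
      by_cases hc : c = root
      · have : Subsingleton {v // branch v = c} := by
          subst hc
          exact ⟨fun u v => Subtype.ext
            ((T.branch_eq_root_iff.1 u.2).trans (T.branch_eq_root_iff.1 v.2).symm)⟩
        rw [Subsingleton.elim (τ⁻¹ c) 1]
        exact Routable.one _ _
      · have h := hcard c hc
        rw [Nat.card_eq_fintype_card] at h
        have hpos : 0 < Fintype.card V := Fintype.card_pos_iff.2 ⟨root⟩
        exact (ih (Fintype.card {v // branch v = c}) (by omega) (T.connected_induce hc hne)
          (τ⁻¹ c) (Fintype.card_congr (Equiv.refl _))).mono (by omega)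
    have hσ : σ = ρ * fiberHom branch τ⁻¹ := by
      rw [map_inv, hτ]
      group
    rw [hσ]
    exact (hρ.mul (Routable.fiberHom branch hbranch)).mono (by omega)

/-- Routing a permutation by stages that always swap. -/
theorem Routable.exists_network [DecidableEq V] {G : SimpleGraph V} {k : ℕ} {σ : Perm V}
    (hσ : Routable G k σ) :
    ∃ M : List (SortStep V), M.length = k ∧ (∀ s ∈ M, s.WF G) ∧
      ∀ x : V → ℕ, applyNetwork M x = x ∘ σ := by
  induction k generalizing σ with
  | zero =>
    obtain rfl : σ = 1 := hσ
    exact ⟨[], rfl, by simp, fun _ => rfl⟩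
  | succ k ih =>
    obtain ⟨f, τ, hf, hτ, rfl⟩ := hσ
    obtain ⟨M, hM, hwf, happ⟩ := ih hτ
    refine ⟨⟨f, fun _ => true, fun _ => true⟩ :: M, by simp [hM], ?_, fun x => ?_⟩
    · simp only [List.mem_cons, forall_eq_or_imp]
      exact ⟨⟨hf.1, hf.2, fun _ _ => rfl, fun _ _ h => by simp at h⟩, hwf⟩
    · have hstep : SortStep.apply ⟨f, fun _ => true, fun _ => true⟩ x = x ∘ f := by
        funext v
        by_cases hv : f v = v <;> simp [SortStep.apply, hv]
      rw [applyNetwork, List.foldl_cons, hstep]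
      exact happ _

theorem exists_equiv_fin [Fintype V] {rk : V → ℕ} (h : Function.Injective rk) :
    ∃ e : Fin (Fintype.card V) ≃ V, ∀ i j, rk (e i) ≤ rk (e j) ↔ i ≤ j := by
  let _ : LinearOrder V := LinearOrder.lift' rk h
  let e := monoEquivOfFin V rfl
  exact ⟨e.toEquiv, fun i j => e.le_iff_le⟩

/-- Two injective rankings differ by a permutation. -/
theorem exists_perm_rank_le [Finite V] {r s : V → ℕ} (hr : Function.Injective r)
    (hs : Function.Injective s) : ∃ σ : Perm V, ∀ u v, s u ≤ s v → r (σ u) ≤ r (σ v) := by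
  have := Fintype.ofFinite V
  obtain ⟨e, he⟩ := exists_equiv_fin hr
  obtain ⟨d, hd⟩ := exists_equiv_fin hs
  refine ⟨d.symm.trans e, fun u v h => (he _ _).2 ((hd _ _).1 ?_)⟩
  simpa using h

end PermRouting

/-- Fixing the target sorted ordering costs at most an additive `O(n)` over the
optimal sorting-network depth: `st(G, π) ≤ st(G) + O(n)` for connected `G`. -/
theorem sortingNumberOrd_le_sortingNumber_add_linear :
    ∃ C : ℕ, ∀ (V : Type) (_ : Fintype V) (_ : DecidableEq V) (G : SimpleGraph V),
      G.Connected → ∀ rk : V → ℕ, Function.Injective rk →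
        sortingNumberOrd G rk ≤ sortingNumber G + C * Fintype.card V := by
  refine ⟨18, fun V _ _ G hG rk hrk => ?_⟩
  rcases Set.eq_empty_or_nonempty {k | ∃ (M : List (SortStep V)) (rk : V → ℕ),
    M.length = k ∧ IsSortingNetwork G M rk} with he | hne
  · have : {k | ∃ M : List (SortStep V), M.length = k ∧ IsSortingNetwork G M rk} = ∅ :=
      Set.eq_empty_of_forall_notMem fun k ⟨M, hM⟩ =>
        Set.notMem_empty k (he ▸ (⟨M, rk, hM⟩ : k ∈ {k | ∃ (M : List (SortStep V))
          (rk : V → ℕ), M.length = k ∧ IsSortingNetwork G M rk}))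
    rw [sortingNumberOrd, this, Nat.sInf_empty]
    exact Nat.zero_le _
  · obtain ⟨M, r, hlen, hr, hwf, hsort⟩ := Nat.sInf_mem hne
    obtain ⟨σ, hσ⟩ := PermRouting.exists_perm_rank_le hr hrk
    obtain ⟨N, hN, hNwf, happ⟩ := (PermRouting.routable_of_connected hG σ).exists_network
    refine Nat.sInf_le ⟨M ++ N, ?_, hrk, fun s hs => ?_, fun x u v huv => ?_⟩
    · rw [List.length_append, hlen, hN]
      rfl
    · exact (List.mem_append.1 hs).elim (hwf s) (hNwf s)
    · have happend : applyNetwork (M ++ N) x = applyNetwork M x ∘ σ := by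
        rw [← happ, applyNetwork, List.foldl_append]
        rfl
      rw [happend]
      exact hsort x _ _ (hσ u v huv)
end

section
/- For any tree T on n vertices with maximum degree Δ, the sorting number satisfies st(T) = O(min(Δ^2 · n, n^2)). -/
/-! ### Odd-even transposition sort on positions `0, …, n - 1` -/

/-- Round `t` of odd-even transposition sort: positions `k - 1` and `k` are compared whenever
`0 < k < n` and `k` has the parity of `t`. -/
def oddEvenRound (n t : ℕ) (y : ℕ → ℕ) (k : ℕ) : ℕ :=
  if k % 2 = t % 2 then (if k = 0 then y k else max (y (k - 1)) (y k))
  else if k + 1 < n then min (y k) (y (k + 1)) else y k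

/-- The first `t` rounds of odd-even transposition sort. -/
def oddEvenIter (n : ℕ) (y : ℕ → ℕ) : ℕ → ℕ → ℕ
  | 0 => y
  | t + 1 => oddEvenRound n t (oddEvenIter n y t)

/-- The number of positions in `[i, n)` holding a value above `c`. -/
def countAbove (n c : ℕ) (y : ℕ → ℕ) (i : ℕ) : ℕ :=
  ((Finset.Ico i n).filter (fun k => c < y k)).card

lemma countAbove_of_le {n i : ℕ} (c : ℕ) (y : ℕ → ℕ) (h : n ≤ i) : countAbove n c y i = 0 := by
  simp [countAbove, h]

lemma countAbove_eq_add {n i : ℕ} (c : ℕ) (y : ℕ → ℕ) (h : i < n) :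
    countAbove n c y i = (if c < y i then 1 else 0) + countAbove n c y (i + 1) := by
  unfold countAbove
  rw [← Finset.insert_Ico_add_one_left_eq_Ico h, Finset.filter_insert]
  split_ifs with hc
  · rw [Finset.card_insert_of_notMem (by simp), add_comm]
  · simp

lemma countAbove_oddEvenRound_of_ne {n t : ℕ} (c : ℕ) (y : ℕ → ℕ) (i : ℕ) (h : i % 2 ≠ t % 2) :
    countAbove n c (oddEvenRound n t y) i = countAbove n c y i := by
  induction hd : n - i using Nat.strong_induction_on generalizing i with
  | _ d ih =>
    rcases le_or_gt n i with hi | hi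
    · rw [countAbove_of_le _ _ hi, countAbove_of_le _ _ hi]
    · rcases le_or_gt n (i + 1) with hi1 | hi1
      · rw [countAbove_eq_add _ _ hi, countAbove_eq_add _ _ hi,
          countAbove_of_le _ _ hi1, countAbove_of_le _ _ hi1]
        have : oddEvenRound n t y i = y i := by
          simp only [oddEvenRound, if_neg h, if_neg (not_lt.2 hi1)]
        rw [this]
      · have h1 : oddEvenRound n t y i = min (y i) (y (i + 1)) := by
          simp only [oddEvenRound, if_neg h, if_pos hi1]
        have h2 : oddEvenRound n t y (i + 1) = max (y i) (y (i + 1)) := by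
          have : (i + 1) % 2 = t % 2 := by omega
          simp [oddEvenRound, this]
        rw [countAbove_eq_add _ _ hi, countAbove_eq_add _ _ hi, countAbove_eq_add _ _ hi1,
          countAbove_eq_add _ _ hi1, ih (n - (i + 1 + 1)) (by omega) (i + 1 + 1) (by omega) rfl,
          h1, h2]
        simp only [lt_min_iff, lt_max_iff]
        split_ifs <;> omega

lemma countAbove_oddEvenRound_zero {n t : ℕ} (c : ℕ) (y : ℕ → ℕ) :
    countAbove n c (oddEvenRound n t y) 0 = countAbove n c y 0 := by
  by_cases h : 0 % 2 = t % 2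
  · rcases Nat.eq_zero_or_pos n with hn | hn
    · rw [countAbove_of_le _ _ hn.le, countAbove_of_le _ _ hn.le]
    · rw [countAbove_eq_add _ _ hn, countAbove_eq_add _ _ hn,
        countAbove_oddEvenRound_of_ne _ _ _ (by omega)]
      have : oddEvenRound n t y 0 = y 0 := by simp only [oddEvenRound, if_pos h, if_true]
      rw [this]
  · exact countAbove_oddEvenRound_of_ne _ _ _ h

lemma le_countAbove_oddEvenRound {n t i j : ℕ} (c : ℕ) (y : ℕ → ℕ) (h : (i + 1) % 2 = t % 2)
    (hi : i + 1 < n) (h1 : j ≤ countAbove n c y i) (h2 : j ≤ countAbove n c y (i + 2) + 1) :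
    j ≤ countAbove n c (oddEvenRound n t y) (i + 1) := by
  have hmax : oddEvenRound n t y (i + 1) = max (y i) (y (i + 1)) := by
    simp [oddEvenRound, h]
  rw [countAbove_eq_add _ _ (by omega), countAbove_eq_add _ _ hi] at h1
  rw [countAbove_eq_add _ _ hi, countAbove_oddEvenRound_of_ne _ _ _ (by omega), hmax]
  simp only [lt_max_iff]
  rw [show i + 2 = i + 1 + 1 from rfl] at *
  split_ifs at h1 ⊢ <;> omega

lemma countAbove_anti {n c : ℕ} (y : ℕ → ℕ) {i j : ℕ} (h : i ≤ j) :
    countAbove n c y j ≤ countAbove n c y i :=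
  Finset.card_le_card (Finset.filter_subset_filter _ (Finset.Ico_subset_Ico_left h))

lemma countAbove_oddEvenIter_zero {n : ℕ} (c : ℕ) (y : ℕ → ℕ) (t : ℕ) :
    countAbove n c (oddEvenIter n y t) 0 = countAbove n c y 0 := by
  induction t with
  | zero => rfl
  | succ t ih => rw [oddEvenIter, countAbove_oddEvenRound_zero, ih]

lemma countAbove_zero_le {n : ℕ} (c : ℕ) (y : ℕ → ℕ) (i : ℕ) :
    countAbove n c y 0 ≤ countAbove n c y i + i := by
  induction i with
  | zero => simp
  | succ i ih =>
    rcases lt_or_ge i n with h | h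
    · rw [countAbove_eq_add _ _ h] at ih
      split_ifs at ih <;> omega
    · rw [countAbove_of_le _ _ h] at ih
      omega

/-- The quantitative invariant: the `j`-th largest value above `c` waits for at most about `j`
rounds and then moves up one position per round. The odd number `2 * m + 1` stands for the total
number of values above `c`, rounded down so that the bound on position `i` changes only in rounds
in which `i - 1` and `i` are compared. -/
lemma le_countAbove_oddEvenIter {n m : ℕ} (c : ℕ) (y : ℕ → ℕ)
    (hm : 2 * m + 1 ≤ countAbove n c y 0) (t i j : ℕ) (hj : j ≤ countAbove n c y 0)
    (hij : i + j ≤ n) (ht : i + 2 * j ≤ 2 * m + 1 + t) :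
    j ≤ countAbove n c (oddEvenIter n y t) i := by
  induction t generalizing i j with
  | zero =>
    have := countAbove_zero_le (n := n) c y i
    simp only [oddEvenIter]
    omega
  | succ t ih =>
    rw [oddEvenIter]
    rcases i with _ | i
    · rw [countAbove_oddEvenRound_zero, countAbove_oddEvenIter_zero]
      exact hj
    · rcases Nat.eq_zero_or_pos j with rfl | hjpos
      · exact Nat.zero_le _
      by_cases hp : (i + 1) % 2 = t % 2
      · refine le_countAbove_oddEvenRound _ _ hp (by omega)
          (ih i j hj (by omega) (by omega)) ?_
        have := ih (i + 2) (j - 1) (by omega) (by omega) (by omega)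
        omega
      · rw [countAbove_oddEvenRound_of_ne _ _ _ hp]
        exact ih (i + 1) j hj hij (by omega)

theorem oddEvenIter_sorted {n : ℕ} (y : ℕ → ℕ) {a b : ℕ} (hab : a ≤ b) (hb : b < n) :
    oddEvenIter n y (n + 1) a ≤ oddEvenIter n y (n + 1) b := by
  by_contra! hlt
  set z := oddEvenIter n y (n + 1) with hz
  have hne : a < b := lt_of_le_of_ne hab (by rintro rfl; exact lt_irrefl _ hlt)
  set c := z b with hc
  have hK := countAbove_oddEvenIter_zero (n := n) c y (n + 1)
  rw [← hz] at hK
  have hstep : countAbove n c z b + 1 ≤ countAbove n c z 0 := by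
    have h1 := countAbove_anti (n := n) (c := c) z (Nat.zero_le a)
    rw [countAbove_eq_add _ _ (by omega), if_pos hlt] at h1
    have h2 := countAbove_anti (n := n) (c := c) z (show a + 1 ≤ b from hne)
    omega
  have hlast : countAbove n c z b + (b + 1) ≤ n := by
    rw [countAbove_eq_add _ _ hb, if_neg (by simp [hc])]
    have : countAbove n c z (b + 1) ≤ n - (b + 1) :=
      (Finset.card_filter_le _ _).trans (by simp)
    omega
  have := le_countAbove_oddEvenIter (n := n) (m := (countAbove n c y 0 - 1) / 2) c y (by omega)
    (n + 1) b (countAbove n c z b + 1) (by omega) (by omega) (by omega)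
  rw [← hz] at this
  omega

/-! ### Hamiltonian paths in the cube of a connected graph -/

namespace SimpleGraph

variable {V : Type*}

/-- `u` and `w` are joined by a walk of length at most three. -/
def Near (G : SimpleGraph V) (u w : V) : Prop :=
  ∃ a b, (u = a ∨ G.Adj u a) ∧ (a = b ∨ G.Adj a b) ∧ (b = w ∨ G.Adj b w)

lemma Near.symm {G : SimpleGraph V} {u w : V} (h : G.Near u w) : G.Near w u := by
  obtain ⟨a, b, h1, h2, h3⟩ := h
  exact ⟨b, a, h3.imp Eq.symm Adj.symm, h2.imp Eq.symm Adj.symm, h1.imp Eq.symm Adj.symm⟩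

lemma Near.exists_walk {G : SimpleGraph V} {u w : V} (h : G.Near u w) (hne : w ≠ u) :
    ∃ a b, (u = a ∨ G.Adj u a) ∧ (a = b ∨ G.Adj a b) ∧ G.Adj b w ∧ w ≠ a := by
  obtain ⟨a, b, h1, h2, h3⟩ := h
  rcases eq_or_ne w a with rfl | ha
  · exact ⟨u, u, .inl rfl, .inl rfl, h1.resolve_left hne.symm, hne⟩
  rcases h3 with rfl | h3
  · exact ⟨a, a, h1, .inl rfl, h2.resolve_left ha.symm, ha⟩
  · exact ⟨a, b, h1, h2, h3, ha⟩

/-- Vertex sets obtained from single vertices by repeatedly joining two disjoint rooted sets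
along an edge between their roots. -/
inductive Rooted [DecidableEq V] (G : SimpleGraph V) : V → Finset V → Prop
  | single (u : V) : Rooted G u {u}
  | join {u v : V} {A B : Finset V} : Rooted G u A → Rooted G v B → G.Adj u v → Disjoint A B →
      Rooted G u (A ∪ B)

lemma Rooted.insert [DecidableEq V] {G : SimpleGraph V} {u : V} {A : Finset V} (h : G.Rooted u A)
    {p w : V} (hp : p ∈ A) (hw : w ∉ A) (hpw : G.Adj p w) : G.Rooted u (insert w A) := by
  induction h with
  | single u =>
    obtain rfl := Finset.mem_singleton.1 hp
    rw [Finset.insert_eq, Finset.union_comm]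
    exact .join (.single p) (.single w) hpw (by simpa using fun h => hw (by simp [h]))
  | @join u v A B hA hB huv hAB ihA ihB =>
    rw [Finset.mem_union, not_or] at hw
    rcases Finset.mem_union.1 hp with hp | hp
    · rw [← Finset.insert_union]
      exact .join (ihA hp hw.1) hB huv (Finset.disjoint_insert_left.2 ⟨hw.2, hAB⟩)
    · rw [← Finset.union_insert]
      exact .join hA (ihB hp hw.2) huv (Finset.disjoint_insert_right.2 ⟨hw.1, hAB⟩)

lemma Connected.rooted_univ [DecidableEq V] [Fintype V] {G : SimpleGraph V} (hG : G.Connected)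
    (r : V) : G.Rooted r Finset.univ := by
  have key : ∀ k, k + 1 ≤ Fintype.card V → ∃ A : Finset V, G.Rooted r A ∧ A.card = k + 1 := by
    intro k
    induction k with
    | zero => exact fun _ => ⟨{r}, .single r, by simp⟩
    | succ k ih =>
      intro hk
      obtain ⟨A, hA, hcard⟩ := ih (by omega)
      obtain ⟨a, ha⟩ : A.Nonempty := Finset.card_pos.1 (by omega)
      obtain ⟨b, hb⟩ : ∃ b, b ∉ A := by
        by_contra! hall
        rw [Finset.eq_univ_iff_forall.2 hall, Finset.card_univ] at hcard
        omega
      obtain ⟨p⟩ := hG.preconnected a b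
      obtain ⟨d, -, hd1, hd2⟩ := p.exists_boundary_dart (A : Set V) ha hb
      exact ⟨_, hA.insert hd1 hd2 d.adj, by rw [Finset.card_insert_of_notMem hd2, hcard]⟩
  have : 0 < Fintype.card V := Fintype.card_pos_iff.2 ⟨r⟩
  obtain ⟨A, hA, hcard⟩ := key (Fintype.card V - 1) (by omega)
  rwa [(Finset.card_eq_iff_eq_univ A).1 (by omega)] at hA

/-- A rooted set is traversed, in steps of length at most three, by a list starting at the root
and ending at the root or one of its neighbours. -/
lemma Rooted.exists_list [DecidableEq V] {G : SimpleGraph V} {u : V} {A : Finset V}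
    (h : G.Rooted u A) : ∃ (l : List V) (hl : l ≠ []), l.Nodup ∧ l.toFinset = A ∧
      l.IsChain G.Near ∧ l.head hl = u ∧ (l.getLast hl = u ∨ G.Adj (l.getLast hl) u) := by
  induction h with
  | single u => exact ⟨[u], by simp⟩
  | @join u v A B hA hB huv hAB ihA ihB =>
    obtain ⟨l, hl, hnd, hlA, hch, hhd, hlast⟩ := ihA
    obtain ⟨l', hl', hnd', hlB, hch', hhd', hlast'⟩ := ihB
    refine ⟨l ++ l'.reverse, by simp [hl], ?_, ?_, ?_, ?_, ?_⟩
    · refine hnd.append (List.nodup_reverse.2 hnd') fun x hx hx' => ?_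
      have hxA : x ∈ A := by simpa [← hlA] using hx
      have hxB : x ∈ B := by simpa [← hlB] using hx'
      exact Finset.disjoint_left.1 hAB hxA hxB
    · simp [hlA, hlB]
    · refine List.isChain_append.2 ⟨hch, ?_, ?_⟩
      · rw [List.isChain_reverse]
        exact hch'.imp fun _ _ => Near.symm
      · intro x hx y hy
        rw [List.getLast?_eq_some_getLast hl, Option.mem_some_iff] at hx
        rw [List.head?_reverse, List.getLast?_eq_some_getLast hl', Option.mem_some_iff] at hy
        subst hx hy
        exact ⟨u, v, hlast, .inr huv, hlast'.imp Eq.symm Adj.symm⟩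
    · rw [List.head_append_of_ne_nil hl, hhd]
    · right
      rw [List.getLast_append_of_ne_nil _ (by simpa using hl'), List.getLast_reverse, hhd']
      exact huv.symm

theorem Connected.exists_near_enumeration [Fintype V] {G : SimpleGraph V} (hG : G.Connected) :
    ∃ (rk : V → ℕ) (f : ℕ → V), (∀ v, rk v < Fintype.card V) ∧ (∀ v, f (rk v) = v) ∧
      (∀ i < Fintype.card V, rk (f i) = i) ∧
      ∀ i, i + 1 < Fintype.card V → G.Near (f i) (f (i + 1)) := by
  classical
  obtain ⟨r⟩ := hG.nonempty
  obtain ⟨l, -, hnd, hl, hch, -⟩ := (hG.rooted_univ r).exists_list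
  have hlen : l.length = Fintype.card V := by
    rw [← List.toFinset_card_of_nodup hnd, hl, Finset.card_univ]
  have hmem : ∀ v, v ∈ l := fun v => by rw [← List.mem_toFinset, hl]; simp
  refine ⟨fun v => l.idxOf v, fun i => l.getD i r, fun v => ?_, fun v => ?_, fun i hi => ?_,
    fun i hi => ?_⟩
  · rw [← hlen]
    exact List.idxOf_lt_length_of_mem (hmem v)
  · have := List.idxOf_lt_length_of_mem (hmem v)
    simp only [List.getD_eq_getElem _ _ this, List.getElem_idxOf]
  · have hi' : i < l.length := hlen ▸ hi
    simp only [List.getD_eq_getElem _ _ hi']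
    exact hnd.idxOf_getElem i hi'
  · have hi' : i + 1 < l.length := hlen ▸ hi
    simp only [List.getD_eq_getElem _ _ hi', List.getD_eq_getElem _ _ (Nat.lt_of_succ_lt hi')]
    exact List.isChain_iff_getElem.1 hch i hi'

end SimpleGraph

/-! ### Greedy colouring -/

lemma Finset.exists_greedy_coloring {V : Type*} [DecidableEq V] (r : V → V → Prop)
    [DecidableRel r] (hr : ∀ u v, r u v → r v u) (D : ℕ) (s : Finset V)
    (hD : ∀ u ∈ s, (s.filter (r u)).card ≤ D) :
    ∃ c : V → ℕ, (∀ u, c u < D + 1) ∧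
      ∀ u ∈ s, ∀ v ∈ s, u ≠ v → r u v → c u ≠ c v := by
  induction s using Finset.induction_on with
  | empty => exact ⟨fun _ => 0, by simp⟩
  | insert a s ha ih =>
    obtain ⟨c, hc, hprop⟩ := ih fun u hu =>
      (Finset.card_le_card (Finset.filter_subset_filter _ (Finset.subset_insert a s))).trans
        (hD u (Finset.mem_insert_of_mem hu))
    obtain ⟨k, hk, hk'⟩ : ∃ k ∈ Finset.range (D + 1), k ∉ (s.filter (r a)).image c := by
      refine Finset.exists_mem_notMem_of_card_lt_card ?_
      rw [Finset.card_range, Nat.lt_succ_iff]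
      exact Finset.card_image_le.trans ((Finset.card_le_card (Finset.filter_subset_filter _
        (Finset.subset_insert a s))).trans (hD a (Finset.mem_insert_self a s)))
    have hfree : ∀ v ∈ s, r a v → c v ≠ k := fun v hv hav h =>
      hk' (Finset.mem_image.2 ⟨v, Finset.mem_filter.2 ⟨hv, hav⟩, h⟩)
    refine ⟨Function.update c a k, fun u => ?_, fun u hu v hv huv hruv => ?_⟩
    · rcases eq_or_ne u a with rfl | h
      · simpa using hk
      · simpa [h] using hc u
    · rcases Finset.mem_insert.1 hu with rfl | hu' <;> rcases Finset.mem_insert.1 hv with rfl | hv'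
      · exact absurd rfl huv
      · simpa [huv.symm] using (hfree v hv' hruv).symm
      · simpa [huv] using hfree u hu' (hr _ _ hruv)
      · have h1 : u ≠ a := fun h => ha (h ▸ hu')
        have h2 : v ≠ a := fun h => ha (h ▸ hv')
        simpa [h1, h2] using hprop u hu' v hv' huv hruv

/-! ### Elementary steps and their parallel combination -/

section Steps

variable {V : Type*}

/-- Exchange the values at `a` and `b`. -/
def swapStep [DecidableEq V] (a b : V) : SortStep V :=
    ⟨Equiv.swap a b, fun _ => true, fun _ => false⟩

/-- Move the smaller of the two values at `a` and `b` to `a`. -/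
def compareStep [DecidableEq V] (a b : V) : SortStep V :=
  ⟨Equiv.swap a b, fun _ => false, fun v => decide (v = a)⟩

/-- The step that does nothing. -/
def idleStep : SortStep V := ⟨id, fun _ => false, fun _ => false⟩

lemma idleStep_WF (G : SimpleGraph V) : (idleStep : SortStep V).WF G := by
  simp [SortStep.WF, idleStep]

lemma swap_adj_of_ne [DecidableEq V] {G : SimpleGraph V} {a b v : V} (h : a = b ∨ G.Adj a b)
    (hv : Equiv.swap a b v ≠ v) : G.Adj v (Equiv.swap a b v) := by
  obtain ⟨hab, rfl | rfl⟩ := Equiv.swap_apply_ne_self_iff.1 hv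
  · simpa using h.resolve_left hab
  · simpa using (h.resolve_left hab).symm

lemma swapStep_WF [DecidableEq V] {G : SimpleGraph V} {a b : V} (h : a = b ∨ G.Adj a b) :
    (swapStep a b).WF G :=
  ⟨fun v => by simp [swapStep], fun _ hv => swap_adj_of_ne h hv, fun _ _ => rfl,
    fun _ _ h => by simp [swapStep] at h⟩

lemma compareStep_WF [DecidableEq V] {G : SimpleGraph V} {a b : V} (h : G.Adj a b) :
    (compareStep a b).WF G := by
  refine ⟨fun v => by simp [compareStep], fun _ hv => swap_adj_of_ne (.inr h) hv, fun _ _ => rfl,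
    fun v hv _ => ?_⟩
  obtain ⟨hab, rfl | rfl⟩ := Equiv.swap_apply_ne_self_iff.1 hv <;>
    simp [compareStep, hab.symm]

lemma swapStep_apply [DecidableEq V] (a b : V) (x : V → ℕ) :
    (swapStep a b).apply x = x ∘ Equiv.swap a b := by
  funext v
  by_cases h : Equiv.swap a b v = v <;> simp [SortStep.apply, swapStep, h]

lemma compareStep_apply [DecidableEq V] {a b : V} (h : a ≠ b) (x : V → ℕ) (v : V) :
    (compareStep a b).apply x v =
      if v = a then min (x a) (x b) else if v = b then max (x a) (x b) else x v := by
  rcases eq_or_ne v a with rfl | ha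
  · simp [SortStep.apply, compareStep, h.symm]
  rcases eq_or_ne v b with rfl | hb
  · simp [SortStep.apply, compareStep, h, h.symm, max_comm]
  · simp [SortStep.apply, compareStep, Equiv.swap_apply_of_ne_of_ne ha hb, ha, hb]

/-- Compare-exchange of `u` and `w` along the walk `u, a, b, w`. -/
def walkProgram [DecidableEq V] (u a b w : V) : List (SortStep V) :=
  [swapStep u a, swapStep a b, compareStep b w, swapStep a b, swapStep u a]

lemma applyNetwork_walkProgram [DecidableEq V] {u a b w : V} (hu : w ≠ u) (ha : w ≠ a) (hb : w ≠ b)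
    (x : V → ℕ) (v : V) : applyNetwork (walkProgram u a b w) x v =
      if v = u then min (x u) (x w) else if v = w then max (x u) (x w) else x v := by
  have h1 : Equiv.swap a b (Equiv.swap u a v) = b ↔ v = u := by
    rw [Equiv.swap_apply_eq_iff, Equiv.swap_apply_right, Equiv.swap_apply_eq_iff,
      Equiv.swap_apply_right]
  have hw : Equiv.swap u a (Equiv.swap a b w) = w := by
    rw [Equiv.swap_apply_of_ne_of_ne ha hb, Equiv.swap_apply_of_ne_of_ne hu ha]
  have h2 : Equiv.swap a b (Equiv.swap u a v) = w ↔ v = w := by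
    rw [Equiv.swap_apply_eq_iff, Equiv.swap_apply_eq_iff, hw]
  simp only [applyNetwork, walkProgram, List.foldl_cons, List.foldl_nil, swapStep_apply,
    Function.comp_apply, compareStep_apply hb.symm, h1, h2, hw, Equiv.swap_apply_right,
    Equiv.swap_apply_self]

/-- Run at each vertex `v` the step `P (own v)`. -/
def combineStep {ι : Type*} (own : V → ι) (P : ι → SortStep V) : SortStep V :=
  ⟨fun v => (P (own v)).partner v, fun v => (P (own v)).swapAlways v, fun v => (P (own v)).lo v⟩

lemma combineStep_WF {ι : Type*} {G : SimpleGraph V} {own : V → ι} {P : ι → SortStep V}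
    (hP : ∀ v, (P (own v)).WF G) (hown : ∀ v, own ((P (own v)).partner v) = own v) :
    (combineStep own P).WF G := by
  refine ⟨fun v => ?_, fun v hv => (hP v).2.1 v hv, fun v hv => ?_, fun v hv hs => ?_⟩
  · simp only [combineStep, hown]
    exact (hP v).1 v
  · simp only [combineStep, hown]
    exact (hP v).2.2.1 v hv
  · simp only [combineStep, hown]
    exact (hP v).2.2.2 v hv hs

lemma applyNetwork_combineStep [DecidableEq V] {ι : Type*} {own : V → ι}
    (Ps : List (ι → SortStep V))
    (hown : ∀ P ∈ Ps, ∀ v, own ((P (own v)).partner v) = own v) (i : ι) (x y : V → ℕ)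
    (hxy : ∀ v, own v = i → x v = y v) (v : V) (hv : own v = i) :
    applyNetwork (Ps.map (combineStep own)) x v = applyNetwork (Ps.map fun P => P i) y v := by
  induction Ps generalizing x y with
  | nil => exact hxy v hv
  | cons P Ps ih =>
    refine ih (fun Q hQ => hown Q (List.mem_cons_of_mem _ hQ)) _ _ fun w hw => ?_
    have hpw : own ((P i).partner w) = i := by
      have := hown P List.mem_cons_self w
      rwa [hw] at this
    simp only [SortStep.apply, combineStep, hw, hxy w hw, hxy _ hpw]

/-! ### Simulating a round of compare-exchanges between near vertices -/

open Classical in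
/-- Compare-exchange each `u ∈ B` with `q u`, the smaller value going to `u`. -/
noncomputable def exchangeOn (q : V → V) (B : Set V) (x : V → ℕ) (v : V) : ℕ :=
  if v ∈ B then min (x v) (x (q v)) else if q v ∈ B then max (x (q v)) (x v) else x v

lemma exchangeOn_exchangeOn {q : V → V} (hq : ∀ v, q (q v) = v) {A B C : Set V}
    (hA : ∀ v ∈ A, q v ∉ A) (hB : B ⊆ A) (hC : C ⊆ A) (hBC : Disjoint B C) (x : V → ℕ) :
    exchangeOn q C (exchangeOn q B x) = exchangeOn q (B ∪ C) x := by
  have hdisj : ∀ v, v ∈ B → v ∉ C := fun v h => Set.disjoint_left.1 hBC h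
  funext v
  simp only [exchangeOn, Set.mem_union]
  rw [hq v]
  have h1 := hdisj v
  have h2 := hdisj (q v)
  have h3 := hA v
  have h4 : v ∈ B → v ∈ A := fun h => hB h
  have h5 : v ∈ C → v ∈ A := fun h => hC h
  have h6 : q v ∈ B → q v ∈ A := fun h => hB h
  have h7 : q v ∈ C → q v ∈ A := fun h => hC h
  by_cases a1 : v ∈ B <;> by_cases a2 : v ∈ C <;> by_cases a3 : q v ∈ B <;>
    by_cases a4 : q v ∈ C <;> simp [a1, a2, a3, a4] <;> tauto

/-- Pairwise disjoint walks `u, a u, b u, q u`, for `u ∈ B`, can be used simultaneously. -/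
lemma exists_network_exchangeOn_of_disjoint [DecidableEq V] {G : SimpleGraph V} {q a b : V → V}
    {B : Set V}
    (hq : ∀ v, q (q v) = v)
    (ha : ∀ u ∈ B, u = a u ∨ G.Adj u (a u)) (hb : ∀ u ∈ B, a u = b u ∨ G.Adj (a u) (b u))
    (hadj : ∀ u ∈ B, G.Adj (b u) (q u)) (hqu : ∀ u ∈ B, q u ≠ u) (hqa : ∀ u ∈ B, q u ≠ a u)
    (hdisj : ∀ u ∈ B, ∀ u' ∈ B, u ≠ u' →
      Disjoint ({u, a u, b u, q u} : Finset V) {u', a u', b u', q u'}) :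
    ∃ M : List (SortStep V), M.length = 5 ∧ (∀ s ∈ M, s.WF G) ∧
      ∀ x : V → ℕ, applyNetwork M x = exchangeOn q B x := by
  classical
  let S : V → Finset V := fun u => {u, a u, b u, q u}
  let own : V → Option V := fun v =>
    if h : ∃ u ∈ B, v ∈ S u then some h.choose else none
  have own_some : ∀ u ∈ B, ∀ v ∈ S u, own v = some u := by
    intro u hu v hv
    have h : ∃ u ∈ B, v ∈ S u := ⟨u, hu, hv⟩
    simp only [own, dif_pos h, Option.some_inj]
    by_contra hne
    exact Finset.disjoint_left.1 (hdisj _ h.choose_spec.1 u hu hne) h.choose_spec.2 hv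
  have of_own : ∀ v u, own v = some u → u ∈ B ∧ v ∈ S u := by
    intro v u h
    by_cases hex : ∃ u ∈ B, v ∈ S u
    · simp only [own, dif_pos hex, Option.some_inj] at h
      exact h ▸ hex.choose_spec
    · simp [own, dif_neg hex] at h
  let lift : (V → SortStep V) → Option V → SortStep V := fun P i => i.elim idleStep P
  let Ps : List (Option V → SortStep V) :=
    [lift fun u => swapStep u (a u), lift fun u => swapStep (a u) (b u),
      lift fun u => compareStep (b u) (q u), lift fun u => swapStep (a u) (b u),
      lift fun u => swapStep u (a u)]
  have lift_own : ∀ P : V → SortStep V, (∀ u, ∀ v ∈ S u, (P u).partner v ∈ S u) →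
      ∀ v, own ((lift P (own v)).partner v) = own v := by
    intro P hP v
    rcases h : own v with _ | u
    · exact h
    · obtain ⟨hu, hv⟩ := of_own v u h
      exact own_some u hu _ (hP u v hv)
  have swap_mem : ∀ (s : Finset V) (c d : V), c ∈ s → d ∈ s → ∀ v ∈ s, Equiv.swap c d v ∈ s := by
    intro s c d hc hd v hv
    rw [Equiv.swap_apply_def]
    split_ifs <;> assumption
  have hown : ∀ P ∈ Ps, ∀ v, own ((P (own v)).partner v) = own v := by
    have h1 := lift_own (fun u => swapStep u (a u)) fun u =>
      swap_mem (S u) _ _ (by simp [S]) (by simp [S])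
    have h2 := lift_own (fun u => swapStep (a u) (b u)) fun u =>
      swap_mem (S u) _ _ (by simp [S]) (by simp [S])
    have h3 := lift_own (fun u => compareStep (b u) (q u)) fun u =>
      swap_mem (S u) _ _ (by simp [S]) (by simp [S])
    simp only [Ps, List.mem_cons, List.not_mem_nil, or_false]
    rintro P (rfl | rfl | rfl | rfl | rfl) <;> assumption
  have lift_WF : ∀ P : V → SortStep V, (∀ u ∈ B, (P u).WF G) → ∀ v, (lift P (own v)).WF G := by
    intro P hP v
    rcases h : own v with _ | u
    · exact idleStep_WF G
    · exact hP u (of_own v u h).1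
  have hWF : ∀ P ∈ Ps, ∀ v, (P (own v)).WF G := by
    have h1 := lift_WF (fun u => swapStep u (a u)) fun u hu => swapStep_WF (ha u hu)
    have h2 := lift_WF (fun u => swapStep (a u) (b u)) fun u hu => swapStep_WF (hb u hu)
    have h3 := lift_WF (fun u => compareStep (b u) (q u)) fun u hu => compareStep_WF (hadj u hu)
    simp only [Ps, List.mem_cons, List.not_mem_nil, or_false]
    rintro P (rfl | rfl | rfl | rfl | rfl) <;> assumption
  refine ⟨Ps.map (combineStep own), rfl, fun s hs => ?_, fun x => funext fun v => ?_⟩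
  · obtain ⟨P, hP, rfl⟩ := List.mem_map.1 hs
    exact combineStep_WF (hWF P hP) (hown P hP)
  · rw [applyNetwork_combineStep Ps hown (own v) x x (fun _ _ => rfl) v rfl]
    have mem_of : v ∈ B → own v = some v := fun h => own_some v h v (by simp [S])
    have mem_of' : q v ∈ B → own v = some (q v) := fun h => own_some _ h v (by simp [S, hq])
    rcases h : own v with _ | u
    · have h1 : v ∉ B := fun hv => by simp [mem_of hv] at h
      have h2 : q v ∉ B := fun hv => by simp [mem_of' hv] at h
      simp [exchangeOn, h1, h2, Ps, lift, applyNetwork, SortStep.apply, idleStep]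
    · obtain ⟨hu, -⟩ := of_own v u h
      have hrun : Ps.map (fun P => P (some u)) = walkProgram u (a u) (b u) (q u) := rfl
      rw [hrun, applyNetwork_walkProgram (hqu u hu) (hqa u hu) (hadj u hu).ne']
      simp only [exchangeOn]
      by_cases hvu : v = u
      · subst hvu
        simp [hu]
      · have h1 : v ∉ B := fun hv => hvu (by simpa [mem_of hv] using h)
        by_cases hvq : v = q u
        · subst hvq
          simp [h1, hu, hq, hvu]
        · have h2 : q v ∉ B := fun hv => hvq (by
            have : q v = u := by simpa [mem_of' hv] using h
            rw [← this, hq])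
          simp [hvu, hvq, h1, h2]

lemma exists_network_exchangeOn [DecidableEq V] [Fintype V] {G : SimpleGraph V}
    [DecidableRel G.Adj] {q : V → V}
    {A : Set V} (hq : ∀ v, q (q v) = v) (hA : ∀ v ∈ A, q v ∉ A)
    (hnear : ∀ u ∈ A, G.Near u (q u)) :
    ∃ M : List (SortStep V), M.length = 5 * (8 * (G.maxDegree + 1) + 1) ∧ (∀ s ∈ M, s.WF G) ∧
      ∀ x : V → ℕ, applyNetwork M x = exchangeOn q A x := by
  classical
  have hqu : ∀ u ∈ A, q u ≠ u := fun u hu h => hA u hu (h.symm ▸ hu)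
  have hw : ∀ u, ∃ a b, u ∈ A →
      (u = a ∨ G.Adj u a) ∧ (a = b ∨ G.Adj a b) ∧ G.Adj b (q u) ∧ q u ≠ a := by
    intro u
    by_cases hu : u ∈ A
    · obtain ⟨a, b, h⟩ := (hnear u hu).exists_walk (hqu u hu)
      exact ⟨a, b, fun _ => h⟩
    · exact ⟨u, u, fun h => absurd h hu⟩
  choose a b hab using hw
  let S : V → Finset V := fun u => {u, a u, b u, q u}
  let N : V → Finset V := fun z => insert z (G.neighborFinset z)
  have hN : ∀ z, (N z).card ≤ G.maxDegree + 1 := fun z =>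
    (Finset.card_insert_le _ _).trans (by simpa using G.degree_le_maxDegree z)
  have hS : ∀ u ∈ A, ∀ z ∈ S u, u ∈ N z ∪ (N z).image q := by
    intro u hu z hz
    obtain ⟨h1, -, h3, -⟩ := hab u hu
    simp only [S, Finset.mem_insert, Finset.mem_singleton] at hz
    simp only [N, Finset.mem_union, Finset.mem_image, Finset.mem_insert,
      SimpleGraph.mem_neighborFinset]
    rcases hz with rfl | rfl | rfl | rfl
    · exact .inl (.inl rfl)
    · exact .inl (h1.imp id SimpleGraph.Adj.symm)
    · exact .inr ⟨q u, .inr h3, hq u⟩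
    · exact .inr ⟨q u, .inl rfl, hq u⟩
  obtain ⟨c, hc, hprop⟩ := Finset.exists_greedy_coloring (fun u u' => ¬ Disjoint (S u) (S u'))
    (fun _ _ h h' => h h'.symm) (8 * (G.maxDegree + 1)) A.toFinset (by
      intro u _
      have hsub : A.toFinset.filter (fun u' => ¬ Disjoint (S u) (S u')) ⊆
          (S u).biUnion fun z => N z ∪ (N z).image q := by
        intro u' hu'
        rw [Finset.mem_filter, Set.mem_toFinset, Finset.not_disjoint_iff] at hu'
        obtain ⟨hu', z, hz, hz'⟩ := hu'
        exact Finset.mem_biUnion.2 ⟨z, hz, hS u' hu' z hz'⟩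
      refine (Finset.card_le_card hsub).trans ((Finset.card_biUnion_le_card_mul _ _
        (2 * (G.maxDegree + 1)) fun z _ => ?_).trans ?_)
      · have h1 := Finset.card_union_le (N z) ((N z).image q)
        have h2 := Finset.card_image_le (s := N z) (f := q)
        have h3 := hN z
        omega
      · have : (S u).card ≤ 4 := Finset.card_le_four
        nlinarith)
  have key : ∀ k, ∃ M : List (SortStep V), M.length = 5 * k ∧ (∀ s ∈ M, s.WF G) ∧
      ∀ x : V → ℕ, applyNetwork M x = exchangeOn q {u | u ∈ A ∧ c u < k} x := by
    intro k
    induction k with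
    | zero => exact ⟨[], by simp, by simp, fun x => by funext v; simp [applyNetwork, exchangeOn]⟩
    | succ k ih =>
      obtain ⟨M, hlen, hWF, hM⟩ := ih
      obtain ⟨M', hlen', hWF', hM'⟩ := exists_network_exchangeOn_of_disjoint (G := G) (q := q)
        (a := a) (b := b) (B := {u | u ∈ A ∧ c u = k}) hq (fun u hu => (hab u hu.1).1)
        (fun u hu => (hab u hu.1).2.1) (fun u hu => (hab u hu.1).2.2.1) (fun u hu => hqu u hu.1)
        (fun u hu => (hab u hu.1).2.2.2) (fun u hu u' hu' hne => by
          by_contra hd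
          exact hprop u (by simpa using hu.1) u' (by simpa using hu'.1) hne hd
            (hu.2.trans hu'.2.symm))
      refine ⟨M ++ M', by simp [hlen, hlen']; ring, fun s hs => ?_, fun x => ?_⟩
      · exact (List.mem_append.1 hs).elim (hWF s) (hWF' s)
      · have happ : applyNetwork (M ++ M') x = applyNetwork M' (applyNetwork M x) :=
          List.foldl_append
        rw [happ, hM, hM', exchangeOn_exchangeOn hq hA (fun _ h => h.1) (fun _ h => h.1)
          (Set.disjoint_left.2 fun v h h' => h.2.ne h'.2)]
        congr 1
        ext v
        simp only [Set.mem_union, Set.mem_ofPred_eq, Nat.lt_succ_iff_lt_or_eq]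
        tauto
  obtain ⟨M, hlen, hWF, hM⟩ := key (8 * (G.maxDegree + 1) + 1)
  refine ⟨M, hlen, hWF, fun x => ?_⟩
  rw [hM]
  congr 1
  ext v
  simpa using fun _ => hc v

/-! ### The sorting network -/

theorem SimpleGraph.Connected.sortingNumber_le [DecidableEq V] [Fintype V] {G : SimpleGraph V}
    [DecidableRel G.Adj] (hG : G.Connected) :
    sortingNumber G ≤ (Fintype.card V + 1) * (5 * (8 * (G.maxDegree + 1) + 1)) := by
  obtain ⟨rk, f, hrk, hf, hrf, hnear⟩ := hG.exists_near_enumeration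
  set n := Fintype.card V with hn
  have hinj : Function.Injective rk := fun u v h => by rw [← hf u, h, hf]
  have round : ∀ t, ∃ M : List (SortStep V), M.length = 5 * (8 * (G.maxDegree + 1) + 1) ∧
      (∀ s ∈ M, s.WF G) ∧ ∀ x : V → ℕ, ∀ v,
        applyNetwork M x v = oddEvenRound n t (x ∘ f) (rk v) := by
    intro t
    let q' : ℕ → ℕ := fun k => if k % 2 = t % 2 then k - 1 else if k + 1 < n then k + 1 else k
    have hq'lt : ∀ k < n, q' k < n := by
      intro k hk
      simp only [q']
      split_ifs <;> omega
    have hq'q' : ∀ k < n, q' (q' k) = k := by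
      intro k hk
      simp only [q']
      split_ifs <;> omega
    have hrq : ∀ v, rk (f (q' (rk v))) = q' (rk v) := fun v => hrf _ (hq'lt _ (hrk v))
    obtain ⟨M, hlen, hWF, hM⟩ := exists_network_exchangeOn (G := G) (q := fun v => f (q' (rk v)))
      (A := {u | rk u % 2 ≠ t % 2 ∧ rk u + 1 < n})
      (fun v => by simp only [hrq, hq'q' _ (hrk v), hf])
      (fun v hv hv' => by
        have h1 := hv.1
        have h2 := hv'.1
        rw [hrq] at h2
        simp only [q', if_neg hv.1, if_pos hv.2] at h2
        omega)
      (fun v hv => by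
        have := hnear (rk v) hv.2
        rw [hf] at this
        simpa only [q', if_neg hv.1, if_pos hv.2] using this)
    refine ⟨M, hlen, hWF, fun x v => ?_⟩
    rw [hM]
    have hv := hrk v
    simp only [exchangeOn, oddEvenRound, Set.mem_ofPred_eq, hrq, Function.comp_apply, hf]
    by_cases hp : rk v % 2 = t % 2
    · rw [if_neg (by tauto), if_pos hp]
      by_cases h0 : rk v = 0
      · rw [if_pos h0, if_neg]
        simp only [q', if_pos hp]
        omega
      · rw [if_neg h0, if_pos]
        · simp only [q', if_pos hp]
        · simp only [q', if_pos hp]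
          omega
    · rw [if_neg hp]
      by_cases h1 : rk v + 1 < n
      · simp only [q', hp, h1, if_true, if_false, ne_eq, not_false_eq_true, and_self]
      · simp [q', hp, h1]
  have rounds : ∀ t, ∃ M : List (SortStep V), M.length = t * (5 * (8 * (G.maxDegree + 1) + 1)) ∧
      (∀ s ∈ M, s.WF G) ∧ ∀ x : V → ℕ, ∀ v,
        applyNetwork M x v = oddEvenIter n (x ∘ f) t (rk v) := by
    intro t
    induction t with
    | zero => exact ⟨[], by simp, by simp, fun x v => by simp [applyNetwork, oddEvenIter, hf]⟩
    | succ t ih =>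
      obtain ⟨M, hlen, hWF, hM⟩ := ih
      obtain ⟨M', hlen', hWF', hM'⟩ := round t
      refine ⟨M ++ M', by rw [List.length_append, hlen, hlen', add_one_mul], fun s hs => ?_,
        fun x v => ?_⟩
      · exact (List.mem_append.1 hs).elim (hWF s) (hWF' s)
      · have happ : applyNetwork (M ++ M') x = applyNetwork M' (applyNetwork M x) :=
          List.foldl_append
        have hpos : ∀ k < n, applyNetwork M x (f k) = oddEvenIter n (x ∘ f) t k := fun k hk => by
          rw [hM, hrf k hk]
        have hv := hrk v
        rw [happ, hM', oddEvenIter]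
        simp only [oddEvenRound, Function.comp_apply]
        split_ifs with h1 h2 h3
        · rw [hpos _ hv]
        · rw [hpos _ hv, hpos _ (by omega)]
        · rw [hpos _ hv, hpos _ h3]
        · rw [hpos _ hv]
  obtain ⟨M, hlen, hWF, hM⟩ := rounds (n + 1)
  refine Nat.sInf_le ⟨M, rk, hlen, hinj, hWF, fun x u v huv => ?_⟩
  rw [hM, hM]
  exact oddEvenIter_sorted _ huv (hrk v)

end Steps

lemma sortingNumber_eq_zero_of_subsingleton {V : Type*} [DecidableEq V] [Subsingleton V]
    (G : SimpleGraph V) : sortingNumber G = 0 :=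
  Nat.eq_zero_of_le_zero <| Nat.sInf_le
    ⟨[], fun _ => 0, rfl, Function.injective_of_subsingleton _, by simp,
      fun x u v _ => by rw [Subsingleton.elim u v]⟩

/-- For any tree `T` on `n` vertices with maximum degree `Δ`, the sorting number
satisfies `st(T) = O(min(Δ² n, n²))`. -/
theorem sortingNumber_tree :
    ∃ C : ℕ, ∀ (V : Type) (_ : Fintype V) (_ : DecidableEq V) (T : SimpleGraph V)
      (_ : DecidableRel T.Adj), T.IsTree →
        sortingNumber T ≤
          C * min (T.maxDegree ^ 2 * Fintype.card V) (Fintype.card V ^ 2) := by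
  refine ⟨170, fun V _ _ T _ hT => ?_⟩
  rcases subsingleton_or_nontrivial V with hV | hV
  · simp [sortingNumber_eq_zero_of_subsingleton]
  obtain ⟨v⟩ := hT.1.nonempty
  have hpos : 0 < T.maxDegree :=
    (hT.1.preconnected.degree_pos_of_nontrivial v).trans_le (T.degree_le_maxDegree v)
  have hlt : T.maxDegree < Fintype.card V := T.maxDegree_lt_card_verts
  refine hT.1.sortingNumber_le.trans ?_
  calc (Fintype.card V + 1) * (5 * (8 * (T.maxDegree + 1) + 1))
      ≤ (2 * Fintype.card V) * (85 * T.maxDegree) := Nat.mul_le_mul (by omega) (by omega)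
    _ = 170 * (T.maxDegree * Fintype.card V) := by ring
    _ ≤ _ := by
      refine Nat.mul_le_mul_left _ (le_min ?_ ?_)
      · exact Nat.mul_le_mul_right _ (Nat.le_self_pow two_ne_zero _)
      · rw [sq]
        exact Nat.mul_le_mul_right _ hlt.le
end
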